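/- arXiv:2002.10873 — 9 statements merged into one kernel-verified Lean document; each statement's English description precedes it below -/
import Mathlib

section
/- Let T : [0,1] → [0,1] preserve the probability measure μ = h·Leb, where the density h is continuous and strictly positive at a point z. Assume T(z) = z, T is C¹ on a neighborhood of z with T' continuous at z and |T'(z)| > 1. Let f : [0,1] → ℝ be injective and C¹ with f'(x) ≠ 0 for all x, with f' continuous at z. Then lim_{r→0⁺} q_0(r) = 1/|T'(z)|, where q_0(r) = μ(f^{−1}B(f(z),r) ∩ T^{−1}f^{−1}B(f(z),r)) / μ(f^{−1}B(f(z),r)); consequently the extremal index θ = 1 − q_0 equals 1 − 1/|T'(z)|. -/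
open MeasureTheory Set Filter Topology
open scoped ENNReal

/-- Near a point of the unit interval, the Lebesgue measure of small balls intersected with the
interval is exactly linear in the radius. -/
theorem exists_volume_ball_inter_unitInterval_eq {z : ℝ} (hz : z ∈ Icc (0 : ℝ) 1) :
    ∃ k : ℝ, 0 < k ∧ ∀ᶠ r in 𝓝[>] (0 : ℝ),
      volume (Metric.ball z r ∩ Icc 0 1) = ENNReal.ofReal (k * r) := by
  rcases hz.1.eq_or_lt with rfl | h0
  · refine ⟨1, one_pos, ?_⟩
    filter_upwards [Ioo_mem_nhdsGT one_pos] with r hr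
    have : Metric.ball (0 : ℝ) r ∩ Icc 0 1 = Ico 0 r := by
      ext x
      simp only [Real.ball_eq_Ioo, mem_inter_iff, mem_Ioo, mem_Icc, mem_Ico]
      grind
    rw [this, Real.volume_Ico, sub_zero, one_mul]
  rcases hz.2.eq_or_lt with rfl | h1
  · refine ⟨1, one_pos, ?_⟩
    filter_upwards [Ioo_mem_nhdsGT one_pos] with r hr
    have : Metric.ball (1 : ℝ) r ∩ Icc 0 1 = Ioc (1 - r) 1 := by
      ext x
      simp only [Real.ball_eq_Ioo, mem_inter_iff, mem_Ioo, mem_Icc, mem_Ioc]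
      grind
    rw [this, Real.volume_Ioc, sub_sub_cancel, one_mul]
  · refine ⟨2, two_pos, ?_⟩
    filter_upwards [Ioo_mem_nhdsGT h0, Ioo_mem_nhdsGT (sub_pos.2 h1)] with r hr hr'
    have : Metric.ball z r ∩ Icc 0 1 = Metric.ball z r := by
      rw [inter_eq_left, Real.ball_eq_Ioo]
      intro x hx
      simp only [mem_Ioo, mem_Icc] at *
      grind
    rw [this, Real.volume_ball]

/-- A density on the unit interval that is continuous and positive at `z` makes the measure of
small balls around `z` asymptotically linear in the radius. -/
theorem exists_tendsto_measureReal_ball_div {h : ℝ → ℝ} {z : ℝ} {μ : Measure ℝ}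
    (hμ : μ = (volume.restrict (Icc 0 1)).withDensity (fun x => ENNReal.ofReal (h x)))
    (hz : z ∈ Icc (0 : ℝ) 1) (hh : ContinuousAt h z) (hhz : 0 < h z) :
    ∃ L : ℝ, 0 < L ∧ Tendsto (fun r => μ.real (Metric.ball z r) / r) (𝓝[>] 0) (𝓝 L) := by
  obtain ⟨k, hk, hvol⟩ := exists_volume_ball_inter_unitInterval_eq hz
  have hball : ∀ r, μ (Metric.ball z r) =
      ∫⁻ x in Metric.ball z r ∩ Icc 0 1, ENNReal.ofReal (h x) := fun r => by
    rw [hμ, withDensity_apply _ Metric.isOpen_ball.measurableSet,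
      Measure.restrict_restrict Metric.isOpen_ball.measurableSet]
  have hmeas : ∀ r, MeasurableSet (Metric.ball z r ∩ Icc 0 1) := fun r =>
    Metric.isOpen_ball.measurableSet.inter measurableSet_Icc
  have near : ∀ {p : ℝ → Prop}, (∀ᶠ x in 𝓝 z, p x) →
      ∀ᶠ r in 𝓝[>] (0 : ℝ), ∀ x ∈ Metric.ball z r, p x := fun {p} hp => by
    obtain ⟨d, hd, hdp⟩ := Metric.eventually_nhds_iff_ball.1 hp
    filter_upwards [Ioo_mem_nhdsGT hd] with r hr x hx
    exact hdp x (Metric.ball_subset_ball hr.2.le hx)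
  have upper : ∀ a, h z < a →
      ∀ᶠ r in 𝓝[>] (0 : ℝ), μ (Metric.ball z r) ≤ ENNReal.ofReal (a * (k * r)) := fun a ha => by
    filter_upwards [near (hh.eventually_lt_const ha), hvol] with r hr hv
    calc μ (Metric.ball z r) ≤ ∫⁻ _ in Metric.ball z r ∩ Icc 0 1, ENNReal.ofReal a := by
          rw [hball]
          exact setLIntegral_mono' (hmeas r) fun x hx => ENNReal.ofReal_le_ofReal (hr x hx.1).le
      _ = ENNReal.ofReal (a * (k * r)) := by
          rw [setLIntegral_const, hv, ENNReal.ofReal_mul (hhz.trans ha).le]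
  have lower : ∀ a, 0 ≤ a → a < h z →
      ∀ᶠ r in 𝓝[>] (0 : ℝ), ENNReal.ofReal (a * (k * r)) ≤ μ (Metric.ball z r) := fun a h0 ha => by
    filter_upwards [near (hh.eventually_const_lt ha), hvol] with r hr hv
    calc ENNReal.ofReal (a * (k * r))
        = ∫⁻ _ in Metric.ball z r ∩ Icc 0 1, ENNReal.ofReal a := by
          rw [setLIntegral_const, hv, ENNReal.ofReal_mul h0]
      _ ≤ μ (Metric.ball z r) := by
          rw [hball]
          exact setLIntegral_mono' (hmeas r) fun x hx => ENNReal.ofReal_le_ofReal (hr x hx.1).le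
  refine ⟨h z * k, mul_pos hhz hk, tendsto_order.2 ⟨fun b hb => ?_, fun b hb => ?_⟩⟩
  · obtain ⟨a, ha, haz⟩ := exists_between (max_lt hhz ((div_lt_iff₀ hk).2 hb))
    filter_upwards [lower a ((le_max_left _ _).trans ha.le) haz, upper (h z + 1) (lt_add_one _),
      self_mem_nhdsWithin] with r hl hu (hr : 0 < r)
    have := (ENNReal.ofReal_le_iff_le_toReal (hu.trans_lt ENNReal.ofReal_lt_top).ne).1 hl
    rw [lt_div_iff₀ hr]
    have hb' : b < a * k := (div_lt_iff₀ hk).1 ((le_max_right _ _).trans_lt ha)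
    calc b * r < a * k * r := by gcongr
      _ ≤ μ.real (Metric.ball z r) := by rwa [mul_assoc]
  · obtain ⟨a, haz, ha⟩ := exists_between ((lt_div_iff₀ hk).2 hb)
    filter_upwards [upper a haz, self_mem_nhdsWithin] with r hu (hr : 0 < r)
    have := ENNReal.toReal_le_of_le_ofReal
      (mul_nonneg (hhz.trans haz).le (mul_pos hk hr).le) hu
    rw [div_lt_iff₀ hr]
    calc μ.real (Metric.ball z r) ≤ a * k * r := by rwa [mul_assoc]
      _ < b * r := by
        gcongr
        exact (lt_div_iff₀ hk).1 ha

/-- If a family of sets is asymptotically squeezed between balls of radius close to `a * r`, and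
the measure of balls of radius `r` is asymptotic to `L * r`, then the measures of the sets are
asymptotic to `a * L * r`. -/
theorem tendsto_measureReal_div_of_ball_subset {X : Type*} [PseudoMetricSpace X]
    [MeasurableSpace X] {μ : Measure X} [IsFiniteMeasure μ] {z : X} {L a : ℝ} (ha : 0 < a)
    (hL : Tendsto (fun r => μ.real (Metric.ball z r) / r) (𝓝[>] 0) (𝓝 L)) {S : ℝ → Set X}
    (hlow : ∀ c, 0 < c → c < a → ∀ᶠ r in 𝓝[>] (0 : ℝ), Metric.ball z (c * r) ⊆ S r)
    (hup : ∀ c, a < c → ∀ᶠ r in 𝓝[>] (0 : ℝ), S r ⊆ Metric.ball z (c * r)) :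
    Tendsto (fun r => μ.real (S r) / r) (𝓝[>] 0) (𝓝 (a * L)) := by
  have scaled : ∀ c, 0 < c →
      Tendsto (fun r => μ.real (Metric.ball z (c * r)) / r) (𝓝[>] 0) (𝓝 (c * L)) := fun c hc => by
    have hscale : Tendsto (fun r => c * r) (𝓝[>] 0) (𝓝[>] (0 : ℝ)) := by
      refine tendsto_nhdsWithin_iff.2 ⟨?_, ?_⟩
      · have : Tendsto (fun r : ℝ => c * r) (𝓝 0) (𝓝 (c * 0)) := tendsto_id.const_mul c
        rw [mul_zero] at this
        exact this.mono_left nhdsWithin_le_nhds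
      · filter_upwards [self_mem_nhdsWithin] with r hr
        exact mul_pos hc hr
    refine ((hL.comp hscale).const_mul c).congr' ?_
    filter_upwards [self_mem_nhdsWithin] with r (hr : 0 < r)
    simp only [Function.comp_apply]
    field_simp
  have hcont : Tendsto (fun c : ℝ => c * L) (𝓝 a) (𝓝 (a * L)) := tendsto_id.mul_const L
  refine tendsto_order.2 ⟨fun b hb => ?_, fun b hb => ?_⟩
  · have hev : ∀ᶠ c in 𝓝[<] a, b < c * L :=
      (hcont.mono_left nhdsWithin_le_nhds).eventually_const_lt hb
    obtain ⟨c, hcb, hc0, hca⟩ := (hev.and (Ioo_mem_nhdsLT ha)).exists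
    filter_upwards [hlow c hc0 hca, (scaled c hc0).eventually_const_lt hcb,
      self_mem_nhdsWithin] with r hsub hlt (hr : 0 < r)
    exact hlt.trans_le (div_le_div_of_nonneg_right (measureReal_mono hsub) hr.le)
  · have hev : ∀ᶠ c in 𝓝[>] a, c * L < b :=
      (hcont.mono_left nhdsWithin_le_nhds).eventually_lt_const hb
    obtain ⟨c, hcb, hca⟩ := (hev.and self_mem_nhdsWithin).exists
    filter_upwards [hup c hca, (scaled c (ha.trans hca)).eventually_lt_const hcb,
      self_mem_nhdsWithin] with r hsub hlt (hr : 0 < r)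
    exact (div_le_div_of_nonneg_right (measureReal_mono hsub) hr.le).trans_lt hlt

theorem HasDerivAt.tendsto_dist_div {g : ℝ → ℝ} {g' z : ℝ} (hg : HasDerivAt g g' z) :
    Tendsto (fun x => dist (g x) (g z) / dist x z) (𝓝[≠] z) (𝓝 |g'|) := by
  refine (hg.tendsto_slope.abs).congr fun x => ?_
  rw [slope_def_field, abs_div, Real.dist_eq, Real.dist_eq]

theorem HasDerivAt.eventually_ball_subset_preimage {g : ℝ → ℝ} {g' z c : ℝ}
    (hg : HasDerivAt g g' z) (hg' : g' ≠ 0) (hc : 0 < c) (hcg : c < 1 / |g'|) :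
    ∀ᶠ r in 𝓝[>] (0 : ℝ), Metric.ball z (c * r) ⊆ g ⁻¹' Metric.ball (g z) r := by
  have hlt : |g'| < 1 / c := (lt_one_div hc (abs_pos.2 hg')).1 hcg
  have hev := eventually_nhdsWithin_iff.1 (hg.tendsto_dist_div.eventually_lt_const hlt)
  obtain ⟨d, hd, hdp⟩ := Metric.eventually_nhds_iff_ball.1 hev
  filter_upwards [Ioo_mem_nhdsGT (div_pos hd hc)] with r hr x hx
  rcases eq_or_ne x z with rfl | hxz
  · exact Metric.mem_ball_self hr.1
  have hxd : x ∈ Metric.ball z d :=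
    Metric.ball_subset_ball ((lt_div_iff₀' hc).1 hr.2).le hx
  have h1 := hdp x hxd hxz
  rw [div_lt_div_iff₀ (dist_pos.2 hxz) hc, one_mul, mul_comm] at h1
  exact lt_of_mul_lt_mul_left (h1.trans hx) hc.le

theorem HasDerivAt.exists_inter_preimage_subset_ball {g : ℝ → ℝ} {g' z c : ℝ}
    (hg : HasDerivAt g g' z) (hg' : g' ≠ 0) (hcg : 1 / |g'| < c) :
    ∃ U ∈ 𝓝 z, ∀ r > 0, U ∩ g ⁻¹' Metric.ball (g z) r ⊆ Metric.ball z (c * r) := by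
  have hc : 0 < c := (one_div_pos.2 (abs_pos.2 hg')).trans hcg
  have hlt : 1 / c < |g'| := (one_div_lt (abs_pos.2 hg') hc).1 hcg
  have hev := eventually_nhdsWithin_iff.1 (hg.tendsto_dist_div.eventually_const_lt hlt)
  refine ⟨_, hev, fun r hr x ⟨hxU, hx⟩ => ?_⟩
  rcases eq_or_ne x z with rfl | hxz
  · exact Metric.mem_ball_self (mul_pos hc hr)
  have h1 : 1 / c < dist (g x) (g z) / dist x z := hxU hxz
  rw [div_lt_div_iff₀ hc (dist_pos.2 hxz), one_mul, mul_comm] at h1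
  exact h1.trans (mul_lt_mul_of_pos_left hx hc)

/-- The preimages of small balls under a continuous injective real function shrink to a point. -/
theorem Continuous.eventually_preimage_ball_subset {f : ℝ → ℝ} (hf : Continuous f)
    (hinj : Function.Injective f) {z : ℝ} {U : Set ℝ} (hU : U ∈ 𝓝 z) :
    ∀ᶠ r in 𝓝[>] (0 : ℝ), f ⁻¹' Metric.ball (f z) r ⊆ U := by
  obtain ⟨d, hd, hdU⟩ := Metric.mem_nhds_iff.1 hU
  have hpos : ∀ {x y : ℝ}, x ≠ y → 0 < dist (f x) (f y) := fun h => dist_pos.2 (hinj.ne h)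
  have hl : z - d ≠ z := by simpa using hd.ne'
  have hr : z + d ≠ z := by simpa using hd.ne'
  filter_upwards [Ioo_mem_nhdsGT (hpos hl), Ioo_mem_nhdsGT (hpos hr)] with r h1 h2 x hx
  refine hdU ?_
  rw [Real.ball_eq_Ioo]
  have hl' := h1.2
  have hr' := h2.2
  have hx' : dist (f x) (f z) < r := hx
  rw [Real.dist_eq] at hl' hr' hx'
  rcases hf.strictMono_of_inj hinj with hm | hm
  · have a1 := hm (show z - d < z by linarith)
    have a2 := hm (show z < z + d by linarith)
    rw [abs_of_neg (by linarith)] at hl'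
    rw [abs_of_pos (by linarith)] at hr'
    rw [abs_lt] at hx'
    exact ⟨hm.lt_iff_lt.1 (by linarith), hm.lt_iff_lt.1 (by linarith)⟩
  · have a1 := hm (show z - d < z by linarith)
    have a2 := hm (show z < z + d by linarith)
    rw [abs_of_pos (by linarith)] at hl'
    rw [abs_of_neg (by linarith)] at hr'
    rw [abs_lt] at hx'
    exact ⟨hm.lt_iff_gt.1 (by linarith), hm.lt_iff_gt.1 (by linarith)⟩

/-- For an invertible `C¹` observable `f` and a fixed point `z` of a map `T`,
the quantity `q₀(r)` converges as `r → 0⁺` to `1/|T'(z)|`, so that the extremal index is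
`θ = 1 - 1/|T'(z)|`. -/
theorem extremal_index_invertible_observable_fixed_point
    (T h : ℝ → ℝ) (z : ℝ)
    (Leb : Measure ℝ) (hLeb : Leb = volume.restrict (Set.Icc 0 1))
    (μ : Measure ℝ) (hμ : μ = Leb.withDensity (fun x => ENNReal.ofReal (h x)))
    (hprob : IsProbabilityMeasure μ)
    (hTmeas : Measurable T) (hTmaps : Set.MapsTo T (Set.Icc 0 1) (Set.Icc 0 1))
    -- `T` preserves `μ`
    (hinv : ∀ A : Set ℝ, MeasurableSet A → μ (T ⁻¹' A) = μ A)
    (hz : z ∈ Set.Icc (0:ℝ) 1)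
    -- the density `h` is continuous and positive at `z`
    (hhcont : ContinuousAt h z) (hhz : 0 < h z)
    -- `z` is a fixed point, `T` is `C¹` near `z` and expanding at `z`
    (hfix : T z = z)
    (T' : ℝ → ℝ) (ε : ℝ) (hε : 0 < ε)
    (hT' : ∀ x ∈ Metric.ball z ε, HasDerivAt T (T' x) x)
    (hT'cont : ContinuousAt T' z) (hexp : 1 < |T' z|)
    -- `f` is injective and `C¹` with nonvanishing derivative, `f'` continuous at `z`
    (f : ℝ → ℝ) (hfinj : Function.Injective f)
    (f' : ℝ → ℝ) (hf' : ∀ x, HasDerivAt f (f' x) x) (hf'0 : ∀ x, f' x ≠ 0)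
    (hf'cont : ContinuousAt f' z) :
    Tendsto (fun r : ℝ =>
        (μ (f ⁻¹' Metric.ball (f z) r ∩ T ⁻¹' (f ⁻¹' Metric.ball (f z) r))).toReal /
          (μ (f ⁻¹' Metric.ball (f z) r)).toReal)
      (𝓝[>] 0) (nhds (1 / |T' z|)) := by
  subst hLeb
  obtain ⟨L, hL, hball⟩ := exists_tendsto_measureReal_ball_div hμ hz hhcont hhz
  have hfz := hf' z
  have hfc : Continuous f := continuous_iff_continuousAt.2 fun x => (hf' x).continuousAt
  have hT'0 : T' z ≠ 0 := abs_pos.1 (one_pos.trans hexp)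
  have hg : HasDerivAt (f ∘ T) (f' z * T' z) z :=
    HasDerivAt.comp z (by rw [hfix]; exact hfz)
      (hT' z (Metric.mem_ball_self hε))
  have hg0 : f' z * T' z ≠ 0 := mul_ne_zero (hf'0 z) hT'0
  have hgz : (f ∘ T) z = f z := congrArg f hfix
  have hden := tendsto_measureReal_div_of_ball_subset (one_div_pos.2 (abs_pos.2 (hf'0 z))) hball
    (S := fun r => f ⁻¹' Metric.ball (f z) r)
    (fun c hc hca => hfz.eventually_ball_subset_preimage (hf'0 z) hc hca) (fun c hc => by
      obtain ⟨U, hU, hUsub⟩ := hfz.exists_inter_preimage_subset_ball (hf'0 z) hc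
      filter_upwards [hfc.eventually_preimage_ball_subset hfinj hU, self_mem_nhdsWithin]
        with r hr hr0 x hx
      exact hUsub r hr0 ⟨hr hx, hx⟩)
  have hnum := tendsto_measureReal_div_of_ball_subset (one_div_pos.2 (abs_pos.2 hg0)) hball
    (S := fun r => f ⁻¹' Metric.ball (f z) r ∩ T ⁻¹' (f ⁻¹' Metric.ball (f z) r))
    (fun c hc hca => by
      have hca' : c < 1 / |f' z| := hca.trans (one_div_lt_one_div_of_lt (abs_pos.2 (hf'0 z))
        (by rw [abs_mul]; exact lt_mul_of_one_lt_right (abs_pos.2 (hf'0 z)) hexp))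
      filter_upwards [hfz.eventually_ball_subset_preimage (hf'0 z) hc hca',
        hg.eventually_ball_subset_preimage hg0 hc hca] with r h1 h2
      rw [hgz] at h2
      exact subset_inter h1 h2) (fun c hc => by
      obtain ⟨U, hU, hUsub⟩ := hg.exists_inter_preimage_subset_ball hg0 hc
      rw [hgz] at hUsub
      filter_upwards [hfc.eventually_preimage_ball_subset hfinj hU, self_mem_nhdsWithin]
        with r hr hr0 x hx
      exact hUsub r hr0 ⟨hr hx.1, hx.2⟩)
  have hf0 := abs_pos.2 (hf'0 z)
  have hlim := hnum.div hden (mul_pos (one_div_pos.2 hf0) hL).ne'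
  have hval : 1 / |f' z * T' z| * L / (1 / |f' z| * L) = 1 / |T' z| := by
    have := abs_pos.2 hT'0
    rw [abs_mul]
    field_simp
  rw [hval] at hlim
  refine hlim.congr' ?_
  filter_upwards [self_mem_nhdsWithin] with r (hr : 0 < r)
  exact div_div_div_cancel_right₀ hr.ne' _ _
end

section
/- Let T(x) = 3x mod 1 on [0,1), which preserves Lebesgue measure Leb. Fix a ∈ (1/2, 1) and define f : [0,1] → ℝ by f(x) = x/a for 0 ≤ x ≤ a and f(x) = (x−1)/(a−1) for a ≤ x ≤ 1. Let z_1 = 1/2 (a fixed point of T), f_0 = f(z_1) = 1/(2a), and z_2 = (3a−1)/(2a), the second preimage of f_0 under f. Assume that T(z_2) ∉ {z_1, z_2}. Then lim_{r→0⁺} q_0(r) = a/3, where q_0(r) = Leb(f^{−1}B(f_0,r) ∩ T^{−1}f^{−1}B(f_0,r)) / Leb(f^{−1}B(f_0,r)); equivalently, the extremal index θ = 1 − q_0 equals 1 − a/3 = 1 − 1/(3(1 + (1−a)/a)). -/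
open MeasureTheory Set Filter Topology
open scoped ENNReal

/-- If `fract (3 * z) ≠ w` with `w ∈ [0, 1)`, then `3 * z` stays away from `n + w`. -/
lemma eventually_four_mul_lt_abs_of_fract_ne {z w : ℝ} (hw₀ : 0 ≤ w) (hw₁ : w < 1)
    (h : Int.fract (3 * z) ≠ w) (n : ℤ) :
    ∀ᶠ r in 𝓝[>] (0 : ℝ), 4 * r < |3 * z - n - w| := by
  have hpos : 0 < |3 * z - n - w| := by
    rw [abs_pos]
    intro h₀
    apply h
    rw [Int.fract_eq_iff]
    exact ⟨hw₀, hw₁, n, by linarith⟩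
  filter_upwards [Ioo_mem_nhdsGT (div_pos hpos four_pos)] with r hr
  linarith [hr.2]

/-- Preimages of small balls about `1 / (2 * a)` under the tent observable are unions of two
intervals. -/
lemma mem_tent_preimage_ball_iff {a z r : ℝ} {f : ℝ → ℝ} (ha₀ : 0 < a) (ha₁ : a < 1)
    (hf : ∀ x, f x = if x ≤ a then x / a else (x - 1) / (a - 1))
    (hz : z = (3 * a - 1) / (2 * a)) (hr₀ : 0 < r) (hr : r < a - 1 / 2) (hr' : r < z - a)
    (x : ℝ) :
    x ∈ f ⁻¹' Metric.ball (1 / (2 * a)) r ↔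
      x ∈ Ioo (1 / 2 - a * r) (1 / 2 + a * r) ∪ Ioo (z - (1 - a) * r) (z + (1 - a) * r) := by
  have har : a * r < r := by nlinarith
  have har' : (1 - a) * r < r := by nlinarith
  rw [mem_preimage, Metric.mem_ball, Real.dist_eq, hf]
  simp only [mem_union, mem_Ioo]
  split_ifs with hx
  · have e : x / a - 1 / (2 * a) = (x - 1 / 2) / a := by field_simp
    rw [e, abs_div, abs_of_pos ha₀, div_lt_iff₀ ha₀, abs_lt]
    constructor
    · rintro ⟨h₁, h₂⟩
      left
      constructor <;> linarith
    · rintro (⟨h₁, h₂⟩ | ⟨h₁, h₂⟩) <;> constructor <;> linarith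
  · have hb : 0 < 1 - a := by linarith
    have hb' : a - 1 ≠ 0 := by linarith
    have e : (x - 1) / (a - 1) - 1 / (2 * a) = -((x - z) / (1 - a)) := by
      have hb'' : 1 - a ≠ 0 := hb.ne'
      rw [hz, ← neg_sub 1 a, div_neg]
      field_simp
      ring
    rw [e, abs_neg, abs_div, abs_of_pos hb, div_lt_iff₀ hb, abs_lt]
    constructor
    · rintro ⟨h₁, h₂⟩
      right
      constructor <;> linarith
    · rintro (⟨h₁, h₂⟩ | ⟨h₁, h₂⟩) <;> constructor <;> linarith

/-- Extremal index for the map `T x = 3x mod 1` and the two-branch piecewise linear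
observable through `(0,0)`, `(a,1)`, `(1,0)`: `q₀(r) → a/3 = 1/(3(1+(1-a)/a))`. -/
theorem extremal_index_tent_observable_triple_map
    (a : ℝ) (ha : a ∈ Set.Ioo (1/2 : ℝ) 1)
    (T f : ℝ → ℝ)
    (hT : ∀ x, T x = Int.fract (3 * x))
    (hf : ∀ x, f x = if x ≤ a then x / a else (x - 1) / (a - 1))
    (z₁ z₂ f₀ : ℝ)
    (hz₁ : z₁ = 1/2) (hf₀ : f₀ = 1 / (2*a)) (hz₂ : z₂ = (3*a - 1) / (2*a))
    -- `z₂` is not sent to `z₁` nor to itself by `T`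
    (hz₂nonper : T z₂ ∉ ({z₁, z₂} : Set ℝ))
    (Leb : Measure ℝ) (hLeb : Leb = volume.restrict (Set.Ico 0 1)) :
    Tendsto (fun r : ℝ =>
        (Leb (f ⁻¹' Metric.ball f₀ r ∩ T ⁻¹' (f ⁻¹' Metric.ball f₀ r))).toReal /
          (Leb (f ⁻¹' Metric.ball f₀ r)).toReal)
      (𝓝[>] 0) (nhds (a / 3)) ∧
      a / 3 = 1 / (3 * (1 + (1 - a) / a)) := by
  obtain ⟨ha₂, ha₁⟩ := ha
  have ha₀ : 0 < a := by linarith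
  refine ⟨?_, by field_simp; ring⟩
  have hza : a < z₂ := by
    rw [hz₂, lt_div_iff₀ (by positivity)]
    nlinarith
  have hz1 : z₂ < 1 := by
    rw [hz₂, div_lt_one (by positivity)]
    linarith
  simp only [mem_insert_iff, mem_singleton_iff, not_or, hT, hz₁] at hz₂nonper
  obtain ⟨hne₁, hne₂⟩ := hz₂nonper
  have hsmall : ∀ {c : ℝ}, 0 < c → ∀ᶠ r in 𝓝[>] (0 : ℝ), r < c := fun hc => by
    filter_upwards [Ioo_mem_nhdsGT hc] with r hr using hr.2
  refine tendsto_const_nhds.congr' ?_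
  filter_upwards [self_mem_nhdsWithin, hsmall (sub_pos.2 ha₂), hsmall (sub_pos.2 hza),
    hsmall (sub_pos.2 hz1), hsmall (show (0 : ℝ) < 1 / 8 by norm_num),
    hsmall (show 0 < (z₂ - 1 / 2) / 4 by linarith),
    eventually_four_mul_lt_abs_of_fract_ne (by norm_num) (by norm_num) hne₁ 1,
    eventually_four_mul_lt_abs_of_fract_ne (by norm_num) (by norm_num) hne₁ 2,
    eventually_four_mul_lt_abs_of_fract_ne (by linarith) hz1 hne₂ 1,
    eventually_four_mul_lt_abs_of_fract_ne (by linarith) hz1 hne₂ 2]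
    with r hr₀ hr₁ hr₂ hr₃ hr₄ hr₅ h₁₁ h₁₂ h₂₁ h₂₂
  replace hr₀ : 0 < r := hr₀
  have har : a * r < r := by nlinarith
  have har₀ : 0 < a * r := by positivity
  have hbr : (1 - a) * r < r := by nlinarith
  have hbr₀ : 0 < (1 - a) * r := mul_pos (by linarith) hr₀
  have hU := mem_tent_preimage_ball_iff ha₀ ha₁ hf hz₂ hr₀ hr₁ hr₂
  have hUeq : f ⁻¹' Metric.ball f₀ r =
      Ioo (1 / 2 - a * r) (1 / 2 + a * r) ∪ Ioo (z₂ - (1 - a) * r) (z₂ + (1 - a) * r) := by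
    rw [hf₀]
    exact Set.ext hU
  have hIeq : f ⁻¹' Metric.ball f₀ r ∩ T ⁻¹' (f ⁻¹' Metric.ball f₀ r) =
      Ioo (1 / 2 - a * r / 3) (1 / 2 + a * r / 3) := by
    rw [hUeq]
    ext x
    simp only [mem_inter_iff, mem_preimage, mem_union, mem_Ioo, hT]
    have hfloor : ∀ n : ℤ, (n : ℝ) ≤ 3 * x → 3 * x < n + 1 → Int.fract (3 * x) = 3 * x - n :=
      fun n h h' => by rw [Int.fract, Int.floor_eq_iff.2 ⟨h, h'⟩]
    have hmid : 1 / 2 - a * r < x → x < 1 / 2 + a * r → Int.fract (3 * x) = 3 * x - 1 :=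
      fun h h' => by
        have := hfloor 1 (by push_cast; linarith) (by push_cast; linarith)
        exact_mod_cast this
    constructor
    · rintro ⟨⟨h₁, h₂⟩ | ⟨h₁, h₂⟩, h⟩
      · rw [hmid h₁ h₂] at h
        rcases h with ⟨h₃, h₄⟩ | ⟨h₃, h₄⟩ <;> constructor <;> linarith
      · exfalso
        push_cast at h₁₁ h₁₂ h₂₁ h₂₂
        rcases lt_or_ge (3 * x) 2 with hx | hx
        · rw [hfloor 1 (by push_cast; linarith) (by push_cast; linarith)] at h
          push_cast at h
          rcases h with ⟨h₃, h₄⟩ | ⟨h₃, h₄⟩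
          · exact h₁₁.not_ge (abs_le.2 ⟨by linarith, by linarith⟩)
          · exact h₂₁.not_ge (abs_le.2 ⟨by linarith, by linarith⟩)
        · rw [hfloor 2 (by push_cast; linarith) (by push_cast; linarith)] at h
          push_cast at h
          rcases h with ⟨h₃, h₄⟩ | ⟨h₃, h₄⟩
          · exact h₁₂.not_ge (abs_le.2 ⟨by linarith, by linarith⟩)
          · exact h₂₂.not_ge (abs_le.2 ⟨by linarith, by linarith⟩)
    · rintro ⟨h₁, h₂⟩
      have h₃ : 1 / 2 - a * r < x := by linarith
      have h₄ : x < 1 / 2 + a * r := by linarith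
      rw [hmid h₃ h₄]
      exact ⟨Or.inl ⟨h₃, h₄⟩, Or.inl ⟨by linarith, by linarith⟩⟩
  have hdisj : Disjoint (Ioo (1 / 2 - a * r) (1 / 2 + a * r))
      (Ioo (z₂ - (1 - a) * r) (z₂ + (1 - a) * r)) := by
    rw [Set.disjoint_left]
    rintro x ⟨h₁, h₂⟩ ⟨h₃, h₄⟩
    linarith
  have hLI : (Leb (f ⁻¹' Metric.ball f₀ r ∩ T ⁻¹' (f ⁻¹' Metric.ball f₀ r))).toReal =
      2 * (a * r) / 3 := by
    rw [hIeq, hLeb, Measure.restrict_eq_self, Real.volume_Ioo, ENNReal.toReal_ofReal]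
    · ring
    · linarith
    · rintro x ⟨h₁, h₂⟩
      constructor <;> linarith
  have hLU : (Leb (f ⁻¹' Metric.ball f₀ r)).toReal = 2 * r := by
    rw [hUeq, hLeb, Measure.restrict_eq_self, measure_union hdisj measurableSet_Ioo,
      Real.volume_Ioo, Real.volume_Ioo, ← ENNReal.ofReal_add, ENNReal.toReal_ofReal]
    · ring
    · linarith
    · linarith
    · linarith
    · rintro x (⟨h₁, h₂⟩ | ⟨h₁, h₂⟩) <;> constructor <;> linarith
  rw [hLI, hLU]
  field_simp
end

section
/- Let T : [−1,1] → [−1,1] be the Hemmer map T(x) = 1 − 2√|x|. Then the probability measure μ with density h(x) = (1−x)/2 with respect to Lebesgue measure on [−1,1] is T-invariant: for every Borel set A ⊆ [−1,1], ∫_{T^{−1}A} (1−x)/2 dx = ∫_A (1−x)/2 dx. -/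
open MeasureTheory Set Filter
open scoped ENNReal

theorem lintegral_Icc_one_sub_div_two {a b : ℝ} (hab : a ≤ b) (hb : b ≤ 1) :
    ∫⁻ x in Icc a b, ENNReal.ofReal ((1 - x) / 2) =
      ENNReal.ofReal ((1 - a) ^ 2 / 4 - (1 - b) ^ 2 / 4) := by
  have hcont : Continuous fun x : ℝ => (1 - x) / 2 := by fun_prop
  rw [← ofReal_integral_eq_lintegral_ofReal
    (hcont.continuousOn.integrableOn_compact isCompact_Icc)]
  · congr 1
    rw [integral_Icc_eq_integral_Ioc, ← intervalIntegral.integral_of_le hab,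
      intervalIntegral.integral_eq_sub_of_hasDerivAt (f := fun x => -((1 - x) ^ 2 / 4))]
    · ring
    · intro x _
      have h : HasDerivAt (fun x : ℝ => -((1 - x) ^ 2 / 4)) _ x :=
        ((((hasDerivAt_id' x).const_sub 1).pow 2).div_const 4).neg
      refine h.congr_deriv ?_
      norm_num
      ring
    · exact hcont.intervalIntegrable a b
  · filter_upwards [ae_restrict_mem measurableSet_Icc] with x hx
    have := hx.2
    simp only [Pi.zero_apply]
    linarith

/-- The Hemmer map `T x = 1 - 2√|x|` on `[-1,1]` preserves the probability measure with
density `(1-x)/2` with respect to Lebesgue measure on `[-1,1]`. -/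
theorem hemmer_map_invariant_measure
    (T : ℝ → ℝ) (hT : ∀ x, T x = 1 - 2 * Real.sqrt |x|)
    (μ : Measure ℝ)
    (hμ : μ = (volume.restrict (Set.Icc (-1:ℝ) 1)).withDensity
      (fun x => ENNReal.ofReal ((1 - x) / 2))) :
    IsProbabilityMeasure μ ∧
      ∀ A : Set ℝ, A ⊆ Set.Icc (-1:ℝ) 1 → MeasurableSet A → μ (T ⁻¹' A) = μ A := by
  have hμ_apply : ∀ s, MeasurableSet s →
      μ s = ∫⁻ x in s ∩ Icc (-1) 1, ENNReal.ofReal ((1 - x) / 2) := by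
    intro s hs
    rw [hμ, withDensity_apply _ hs, Measure.restrict_restrict hs]
  have hprob : IsProbabilityMeasure μ := by
    refine ⟨?_⟩
    rw [hμ_apply _ .univ, univ_inter, lintegral_Icc_one_sub_div_two (by norm_num) le_rfl]
    norm_num
  refine ⟨hprob, fun A _ hA => ?_⟩
  have hTm : Measurable T := by
    rw [funext hT]
    fun_prop
  suffices h : μ.map T = μ by rw [← Measure.map_apply hTm hA, h]
  have := Measure.isFiniteMeasure_map μ T
  refine Measure.ext_of_Ici _ _ fun a => ?_
  rw [Measure.map_apply hTm measurableSet_Ici, hμ_apply _ (hTm measurableSet_Ici),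
    hμ_apply _ measurableSet_Ici]
  have hpre : ∀ x, x ∈ T ⁻¹' Ici a ↔ Real.sqrt |x| ≤ (1 - a) / 2 := by
    intro x
    rw [mem_preimage, mem_Ici, hT]
    constructor <;> intro h <;> linarith
  rcases lt_or_ge 1 a with ha | ha
  · have h₁ : T ⁻¹' Ici a ∩ Icc (-1) 1 = ∅ := by
      ext x
      have := Real.sqrt_nonneg |x|
      simp only [mem_inter_iff, hpre, mem_empty_iff_false, iff_false]
      rintro ⟨h, -⟩
      linarith
    have h₂ : Ici a ∩ Icc (-1) 1 = ∅ := by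
      ext x
      simp only [mem_inter_iff, mem_Ici, mem_Icc, mem_empty_iff_false, iff_false]
      rintro ⟨h, -, h'⟩
      linarith
    rw [h₁, h₂]
  have hc : 0 ≤ (1 - a) / 2 := by linarith
  simp only [Real.sqrt_le_left hc, abs_le] at hpre
  rcases lt_or_ge a (-1) with ha' | ha'
  · congr 2
    ext x
    simp only [mem_inter_iff, hpre, mem_Ici, mem_Icc, and_congr_left_iff]
    rintro ⟨h₁, h₂⟩
    have : 1 ≤ ((1 - a) / 2) ^ 2 := by nlinarith
    constructor
    · intro _
      linarith
    · intro _
      constructor <;> linarith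
  · have hle : ((1 - a) / 2) ^ 2 ≤ 1 := by nlinarith
    have h₁ : T ⁻¹' Ici a ∩ Icc (-1) 1 = Icc (-((1 - a) / 2) ^ 2) (((1 - a) / 2) ^ 2) := by
      rw [inter_eq_left.mpr]
      · ext x
        rw [hpre, mem_Icc]
      · intro x hx
        obtain ⟨h, h'⟩ := (hpre x).mp hx
        constructor <;> linarith
    have h₂ : Ici a ∩ Icc (-1) 1 = Icc a 1 := by
      rw [← Ici_inter_Iic, ← inter_assoc, Ici_inter_Ici, sup_eq_left.mpr ha', Ici_inter_Iic]
    rw [h₁, h₂, lintegral_Icc_one_sub_div_two (by nlinarith) hle,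
      lintegral_Icc_one_sub_div_two ha le_rfl]
    congr 1
    ring
end

section
/- Let μ be a Borel probability measure on ℝ², let z ∈ ℝ², and define the Gaussian observable f(v) = (1/(2π))·exp(−‖v − z‖²/2), which attains its maximum at z. Suppose the pointwise dimension of μ at z exists and equals d, i.e. lim_{r→0⁺} log μ(B(z,r))/log r = d, where B(z,r) is the closed Euclidean ball of radius r about z. Then the local dimension of the image measure f_*μ at f(z) equals d/2: lim_{ε→0⁺} log μ({v ∈ ℝ² : |f(v) − f(z)| ≤ ε}) / log ε = d/2. -/
open MeasureTheory Set Filter Topology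
open scoped ENNReal

/-- If `g ε / ε` has a positive limit as `ε → 0⁺`, then `log (g ε) / log ε → 1`. -/
theorem tendsto_log_div_log_of_tendsto_div {g : ℝ → ℝ} {c : ℝ} (hc : 0 < c)
    (hg : Tendsto (fun ε => g ε / ε) (𝓝[>] 0) (𝓝 c)) :
    Tendsto (fun ε => Real.log (g ε) / Real.log ε) (𝓝[>] 0) (𝓝 1) := by
  have hlog : Tendsto (fun ε => Real.log (g ε / ε)) (𝓝[>] 0) (𝓝 (Real.log c)) :=
    hg.log hc.ne'
  have hquot := (hlog.div_atBot Real.tendsto_log_nhdsGT_zero).add_const 1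
  rw [zero_add] at hquot
  refine hquot.congr' ?_
  filter_upwards [hg.eventually_ne hc.ne', self_mem_nhdsWithin,
    Real.tendsto_log_nhdsGT_zero.eventually_lt_atBot 0] with ε hgε hε hlogε
  have hε0 : ε ≠ 0 := (mem_Ioi.1 hε).ne'
  have hg0 : g ε ≠ 0 := fun h => hgε (by rw [h, zero_div])
  rw [Real.log_div hg0 hε0]
  field_simp [hlogε.ne]
  ring

theorem tendsto_neg_two_mul_log_one_sub_div (a : ℝ) :
    Tendsto (fun ε => -2 * Real.log (1 - a * ε) / ε) (𝓝[>] 0) (𝓝 (2 * a)) := by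
  have hderiv : HasDerivAt (fun ε : ℝ => -2 * Real.log (1 - a * ε)) (2 * a) 0 := by
    have h := (((((hasDerivAt_id (0 : ℝ)).const_mul a).const_sub 1).log
      (by simp)).const_mul (-2))
    exact h.congr_deriv (by simp)
  have h := hderiv.tendsto_slope_zero_right
  refine h.congr fun ε => ?_
  simp [div_eq_inv_mul]

/-- A superlevel set of a Gaussian near its maximum is a closed ball. -/
theorem setOf_abs_gaussian_sub_le_eq_closedBall {E : Type*} [SeminormedAddCommGroup E]
    {b ε : ℝ} (hb : 0 < b) (hε : 0 ≤ ε) (hbε : b * ε < 1) (z : E) :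
    {v | |1 / b * Real.exp (-‖v - z‖ ^ 2 / 2) - 1 / b * Real.exp (-‖z - z‖ ^ 2 / 2)| ≤ ε} =
      Metric.closedBall z √(-2 * Real.log (1 - b * ε)) := by
  ext v
  have hexp : Real.exp (-‖v - z‖ ^ 2 / 2) ≤ 1 :=
    Real.exp_le_one_iff.2 (by nlinarith [sq_nonneg ‖v - z‖])
  have habs : |1 / b * Real.exp (-‖v - z‖ ^ 2 / 2) - 1 / b * Real.exp (-‖z - z‖ ^ 2 / 2)| =
      (1 - Real.exp (-‖v - z‖ ^ 2 / 2)) / b := by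
    rw [abs_of_nonpos]
    · simp only [sub_self, norm_zero]
      norm_num
      ring
    · rw [← mul_sub]
      exact mul_nonpos_of_nonneg_of_nonpos (by positivity) (by simpa using hexp)
  rw [mem_ofPred_eq, habs, div_le_iff₀ hb, Metric.mem_closedBall, dist_eq_norm]
  have hlog : 0 ≤ -2 * Real.log (1 - b * ε) := by
    have := Real.log_nonpos (by linarith : 0 ≤ 1 - b * ε) (by nlinarith)
    linarith
  rw [Real.le_sqrt (norm_nonneg _) hlog, sub_le_comm, mul_comm ε b,
    ← Real.log_le_iff_le_exp (by linarith)]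
  constructor <;> intro h <;> linarith

theorem gaussian_observable_halves_local_dimension
    (μ : Measure (EuclideanSpace ℝ (Fin 2))) [IsProbabilityMeasure μ]
    (z : EuclideanSpace ℝ (Fin 2)) (d : ℝ)
    (f : EuclideanSpace ℝ (Fin 2) → ℝ)
    (hf : ∀ v, f v = (1 / (2 * Real.pi)) * Real.exp (-‖v - z‖ ^ 2 / 2))
    (hd : Tendsto (fun r : ℝ =>
        Real.log ((μ (Metric.closedBall z r)).toReal) / Real.log r)
      (𝓝[>] 0) (nhds d)) :
    Tendsto (fun ε : ℝ =>
        Real.log ((μ {v | |f v - f z| ≤ ε}).toReal) / Real.log ε)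
      (𝓝[>] 0) (nhds (d / 2)) := by
  have hpi : 0 < 2 * Real.pi := Real.two_pi_pos
  set g : ℝ → ℝ := fun ε => -2 * Real.log (1 - 2 * Real.pi * ε)
  have hg : Tendsto (fun ε => g ε / ε) (𝓝[>] 0) (𝓝 (2 * (2 * Real.pi))) :=
    tendsto_neg_two_mul_log_one_sub_div _
  have hgpos : ∀ᶠ ε in 𝓝[>] 0, 0 < g ε := by
    filter_upwards [hg.eventually_const_lt (by positivity : 0 < 2 * (2 * Real.pi)),
      self_mem_nhdsWithin] with ε h hε
    exact (div_pos_iff_of_pos_right hε).1 h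
  have hgzero : Tendsto g (𝓝[>] 0) (𝓝 0) := by
    have h : ContinuousAt g 0 := by
      refine ContinuousAt.const_mul ?_ _
      exact ContinuousAt.log (by fun_prop) (by simp)
    simpa [g] using h.tendsto.mono_left nhdsWithin_le_nhds
  have hradius : Tendsto (fun ε => √(g ε)) (𝓝[>] 0) (𝓝[>] 0) := by
    refine tendsto_nhdsWithin_iff.2 ⟨by simpa using hgzero.sqrt, ?_⟩
    filter_upwards [hgpos] with ε h using Real.sqrt_pos.2 h
  have hlogratio := (tendsto_log_div_log_of_tendsto_div (by positivity) hg).div_const 2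
  have hprod := (hd.comp hradius).mul hlogratio
  rw [mul_one_div] at hprod
  refine hprod.congr' ?_
  have hsmall : ∀ᶠ ε : ℝ in 𝓝[>] 0, 2 * Real.pi * ε < 1 := by
    have h : Tendsto (fun ε : ℝ => 2 * Real.pi * ε) (𝓝[>] 0) (𝓝 0) := by
      have h : Continuous fun ε : ℝ => 2 * Real.pi * ε := by fun_prop
      simpa using (h.tendsto 0).mono_left nhdsWithin_le_nhds
    exact h.eventually_lt_const one_pos
  filter_upwards [self_mem_nhdsWithin, hgpos, hsmall,
    (Real.tendsto_log_nhdsGT_zero.comp hradius).eventually_lt_atBot 0]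
    with ε hε0 hε hsε hlogε
  simp only [hf, Function.comp_apply] at hlogε ⊢
  rw [setOf_abs_gaussian_sub_le_eq_closedBall hpi hε0.le hsε z]
  have hlog : Real.log (g ε) / Real.log ε / 2 = Real.log √(g ε) / Real.log ε := by
    rw [Real.log_sqrt hε.le]
    ring
  rw [hlog, div_mul_div_cancel₀ hlogε.ne]
end

section
/- Fix α ∈ (0,1) and λ_a, λ_b ∈ (0,1) with λ_a + λ_b ≤ 1. Let ν be the self-similar measure on [0,1] obtained as the pushforward, under the coding map (a_n)_{n≥1} ↦ lim_{n→∞} g_{a_1}∘⋯∘g_{a_n}(0) with g_0(x) = λ_a x and g_1(x) = 1 − λ_b + λ_b x, of the infinite product over ℕ of the Bernoulli measure on {0,1} giving mass α to 0 and 1−α to 1, and let μ = ν ⊗ Leb_{[0,1]} on [0,1]². Consider the observable f(x,y) = (x+y)/2. Then for every c ∈ (0,1), the local dimension of the image measure f_*μ at c equals 1: lim_{ε→0⁺} log μ({(x,y) ∈ [0,1]² : |(x+y)/2 − c| ≤ ε}) / log ε = 1. -/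
open MeasureTheory Set Filter Topology
open scoped ENNReal

/-- Partial compositions `g_{ω 0} ∘ ⋯ ∘ g_{ω (n-1)}` of the iterated function system
`{g₀, g₁}`, where the symbol `false` codes `g₀` and `true` codes `g₁`. -/
noncomputable def codePartial (g₀ g₁ : ℝ → ℝ) (ω : ℕ → Bool) : ℕ → ℝ → ℝ
  | 0 => id
  | n + 1 => codePartial g₀ g₁ ω n ∘ (if ω n then g₁ else g₀)

/-- The coding map of the iterated function system `{g₀, g₁}`:
`ω ↦ lim_n g_{ω 0} ∘ ⋯ ∘ g_{ω (n-1)} (0)`. -/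
noncomputable def codingMap (g₀ g₁ : ℝ → ℝ) (ω : ℕ → Bool) : ℝ :=
  limUnder atTop (fun n => codePartial g₀ g₁ ω n 0)

section CodePartial

variable {g₀ g₁ : ℝ → ℝ}

lemma monotone_codePartial (h₀ : Monotone g₀) (h₁ : Monotone g₁) (ω : ℕ → Bool) (n : ℕ) :
    Monotone (codePartial g₀ g₁ ω n) := by
  induction n with
  | zero => exact monotone_id
  | succ n ih =>
    refine ih.comp ?_
    split_ifs
    exacts [h₁, h₀]

lemma monotone_codePartial_apply (h₀ : Monotone g₀) (h₁ : Monotone g₁) {x : ℝ}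
    (hx₀ : x ≤ g₀ x) (hx₁ : x ≤ g₁ x) (ω : ℕ → Bool) :
    Monotone fun n => codePartial g₀ g₁ ω n x := by
  refine monotone_nat_of_le_succ fun n => monotone_codePartial h₀ h₁ ω n ?_
  split_ifs <;> assumption

lemma antitone_codePartial_apply (h₀ : Monotone g₀) (h₁ : Monotone g₁) {x : ℝ}
    (hx₀ : g₀ x ≤ x) (hx₁ : g₁ x ≤ x) (ω : ℕ → Bool) :
    Antitone fun n => codePartial g₀ g₁ ω n x := by
  refine antitone_nat_of_succ_le fun n => monotone_codePartial h₀ h₁ ω n ?_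
  split_ifs <;> assumption

lemma measurable_codePartial_apply (n : ℕ) (x : ℝ) :
    Measurable fun ω => codePartial g₀ g₁ ω n x := by
  induction n generalizing x with
  | zero => exact measurable_const
  | succ n ih =>
    have h : (fun ω => codePartial g₀ g₁ ω (n + 1) x) = fun ω =>
        if ω n = true then codePartial g₀ g₁ ω n (g₁ x) else codePartial g₀ g₁ ω n (g₀ x) := by
      ext ω
      simp only [codePartial, Function.comp_apply]
      split_ifs <;> rfl
    rw [h]
    exact Measurable.ite (measurableSet_eq_fun (measurable_pi_apply n) measurable_const)
      (ih _) (ih _)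

lemma codePartial_eq_iterate_false {ω : ℕ → Bool} {n : ℕ} (h : ∀ i < n, ω i = false) :
    codePartial g₀ g₁ ω n = g₀^[n] := by
  induction n with
  | zero => rfl
  | succ n ih =>
    rw [codePartial, ih fun i hi => h i (by omega), h n n.lt_succ_self, Function.iterate_succ]
    rfl

lemma codePartial_eq_iterate_true {ω : ℕ → Bool} {n : ℕ} (h : ∀ i < n, ω i = true) :
    codePartial g₀ g₁ ω n = g₁^[n] := by
  induction n with
  | zero => rfl
  | succ n ih =>
    rw [codePartial, ih fun i hi => h i (by omega), h n n.lt_succ_self, Function.iterate_succ]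
    rfl

/-- If `0` and `1` are a sub- and a supersolution of both maps, the orbit of `0` is increasing and
stays below the decreasing orbit of `1`, hence converges. -/
lemma tendsto_codingMap (h₀ : Monotone g₀) (h₁ : Monotone g₁)
    (hz₀ : 0 ≤ g₀ 0) (hz₁ : 0 ≤ g₁ 0) (ho₀ : g₀ 1 ≤ 1) (ho₁ : g₁ 1 ≤ 1) (ω : ℕ → Bool) :
    Tendsto (fun n => codePartial g₀ g₁ ω n 0) atTop (𝓝 (codingMap g₀ g₁ ω)) := by
  refine tendsto_nhds_limUnder ⟨_, tendsto_atTop_ciSup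
    (monotone_codePartial_apply h₀ h₁ hz₀ hz₁ ω) ⟨1, ?_⟩⟩
  rintro _ ⟨n, rfl⟩
  exact (monotone_codePartial h₀ h₁ ω n zero_le_one).trans
    (antitone_codePartial_apply h₀ h₁ ho₀ ho₁ ω (Nat.zero_le n))

lemma codingMap_mem_Icc (h₀ : Monotone g₀) (h₁ : Monotone g₁)
    (hz₀ : 0 ≤ g₀ 0) (hz₁ : 0 ≤ g₁ 0) (ho₀ : g₀ 1 ≤ 1) (ho₁ : g₁ 1 ≤ 1) (ω : ℕ → Bool) (n : ℕ) :
    codingMap g₀ g₁ ω ∈ Icc (codePartial g₀ g₁ ω n 0) (codePartial g₀ g₁ ω n 1) := by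
  have ht := tendsto_codingMap h₀ h₁ hz₀ hz₁ ho₀ ho₁ ω
  refine ⟨(monotone_codePartial_apply h₀ h₁ hz₀ hz₁ ω).ge_of_tendsto ht n,
    le_of_tendsto ht ?_⟩
  filter_upwards [eventually_ge_atTop n] with m hm
  exact (monotone_codePartial h₀ h₁ ω m zero_le_one).trans
    (antitone_codePartial_apply h₀ h₁ ho₀ ho₁ ω hm)

lemma measurable_codingMap (h₀ : Monotone g₀) (h₁ : Monotone g₁)
    (hz₀ : 0 ≤ g₀ 0) (hz₁ : 0 ≤ g₁ 0) (ho₀ : g₀ 1 ≤ 1) (ho₁ : g₁ 1 ≤ 1) :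
    Measurable (codingMap g₀ g₁) :=
  measurable_of_tendsto_metrizable (fun n => measurable_codePartial_apply n 0)
    (tendsto_pi_nhds.2 (tendsto_codingMap h₀ h₁ hz₀ hz₁ ho₀ ho₁))

end CodePartial

lemma iterate_one_sub_add_mul_zero (r : ℝ) (n : ℕ) :
    (fun x : ℝ => 1 - r + r * x)^[n] 0 = 1 - r ^ n := by
  induction n with
  | zero => simp
  | succ n ih => rw [Function.iterate_succ_apply', ih]; ring

/-- A quantity squeezed between two positive multiples of `ε` has logarithmic order `1`. -/
lemma tendsto_log_div_log_of_linear_bounds {m : ℝ → ℝ} {k K : ℝ} (hk : 0 < k) (hK : 0 < K)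
    (hm : ∀ᶠ ε in 𝓝[>] (0 : ℝ), k * ε ≤ m ε ∧ m ε ≤ K * ε) :
    Tendsto (fun ε => Real.log (m ε) / Real.log ε) (𝓝[>] 0) (𝓝 1) := by
  have hlim (a : ℝ) : Tendsto (fun ε => Real.log a / Real.log ε + 1) (𝓝[>] 0) (𝓝 1) := by
    simpa using (Real.tendsto_log_nhdsGT_zero.const_div_atBot (Real.log a)).add_const 1
  have hsmall : ∀ᶠ ε in 𝓝[>] (0 : ℝ), ε ∈ Ioo (0 : ℝ) 1 := Ioo_mem_nhdsGT one_pos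
  have hlog {a ε : ℝ} (ha : 0 < a) (hε : ε ∈ Ioo (0 : ℝ) 1) :
      Real.log a / Real.log ε + 1 = Real.log (a * ε) / Real.log ε := by
    rw [Real.log_mul ha.ne' hε.1.ne', add_div, div_self (Real.log_neg hε.1 hε.2).ne]
  refine tendsto_of_tendsto_of_tendsto_of_le_of_le' (hlim K) (hlim k) ?_ ?_
  · filter_upwards [hm, hsmall] with ε h hε
    rw [hlog hK hε]
    exact div_le_div_of_nonpos_of_le (Real.log_neg hε.1 hε.2).le
      (Real.log_le_log ((mul_pos hk hε.1).trans_le h.1) h.2)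
  · filter_upwards [hm, hsmall] with ε h hε
    rw [hlog hk hε]
    exact div_le_div_of_nonpos_of_le (Real.log_neg hε.1 hε.2).le
      (Real.log_le_log (mul_pos hk hε.1) h.1)

lemma two_mul_le_volume_Icc_inter_unitInterval {t ε : ℝ} (ht : t ∈ Icc (0 : ℝ) 1)
    (hε : ε ≤ 1 / 4) :
    ENNReal.ofReal (2 * ε) ≤ volume (Icc (t - 2 * ε) (t + 2 * ε) ∩ Icc 0 1) := by
  rcases le_total ε 0 with h0 | h0
  · rw [ENNReal.ofReal_of_nonpos (by linarith)]
    exact zero_le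
  rw [Icc_inter_Icc, Real.volume_Icc]
  obtain ⟨h1, h2⟩ := ht
  apply ENNReal.ofReal_le_ofReal
  rcases le_total (t - 2 * ε) 0 with h | h <;> rcases le_total (t + 2 * ε) 1 with h' | h' <;>
    simp only [h, h', sup_of_le_left, sup_of_le_right, inf_of_le_left, inf_of_le_right] <;>
    linarith

section ProdVolume

variable (ν : Measure ℝ) (c ε : ℝ)

lemma prod_volume_mean_ball_eq :
    ν.prod (volume.restrict (Icc 0 1)) {p : ℝ × ℝ | |(p.1 + p.2) / 2 - c| ≤ ε} =
      ∫⁻ x, volume (Icc (2 * c - x - 2 * ε) (2 * c - x + 2 * ε) ∩ Icc 0 1) ∂ν := by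
  rw [Measure.prod_apply (measurableSet_le (by fun_prop) measurable_const)]
  refine lintegral_congr fun x => ?_
  have h : Prod.mk x ⁻¹' {p : ℝ × ℝ | |(p.1 + p.2) / 2 - c| ≤ ε} =
      Icc (2 * c - x - 2 * ε) (2 * c - x + 2 * ε) := by
    ext y
    simp only [mem_preimage, mem_ofPred_eq, abs_le, mem_Icc]
    constructor <;> rintro ⟨h1, h2⟩ <;> constructor <;> linarith
  rw [h, Measure.restrict_apply measurableSet_Icc]

lemma prod_volume_mean_ball_le :
    ν.prod (volume.restrict (Icc 0 1)) {p : ℝ × ℝ | |(p.1 + p.2) / 2 - c| ≤ ε} ≤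
      ENNReal.ofReal (4 * ε) * ν univ := by
  rw [prod_volume_mean_ball_eq, ← lintegral_const]
  refine lintegral_mono fun x => (measure_mono inter_subset_left).trans_eq ?_
  rw [Real.volume_Icc]
  ring_nf

lemma le_prod_volume_mean_ball {ε : ℝ} (hε : ε ≤ 1 / 4) :
    ENNReal.ofReal (2 * ε) * ν (Icc (2 * c - 1) (2 * c)) ≤
      ν.prod (volume.restrict (Icc 0 1)) {p : ℝ × ℝ | |(p.1 + p.2) / 2 - c| ≤ ε} := by
  rw [prod_volume_mean_ball_eq, ← setLIntegral_const]
  refine (setLIntegral_mono' measurableSet_Icc fun x hx => ?_).trans (setLIntegral_le_lintegral _ _)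
  exact two_mul_le_volume_Icc_inter_unitInterval ⟨by linarith [hx.2], by linarith [hx.1]⟩ hε

lemma tendsto_log_prod_volume_mean_ball_div_log [IsProbabilityMeasure ν]
    (hpos : 0 < ν (Icc (2 * c - 1) (2 * c))) :
    Tendsto (fun ε : ℝ => Real.log (ν.prod (volume.restrict (Icc 0 1))
      {p : ℝ × ℝ | |(p.1 + p.2) / 2 - c| ≤ ε}).toReal / Real.log ε) (𝓝[>] 0) (𝓝 1) := by
  have hJ : 0 < (ν (Icc (2 * c - 1) (2 * c))).toReal :=
    ENNReal.toReal_pos hpos.ne' (measure_ne_top _ _)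
  refine tendsto_log_div_log_of_linear_bounds (mul_pos two_pos hJ) four_pos ?_
  filter_upwards [Ioo_mem_nhdsGT (show (0 : ℝ) < 1 / 4 by norm_num)] with ε hε
  have hle := prod_volume_mean_ball_le ν c ε
  have hge := le_prod_volume_mean_ball ν c hε.2.le
  rw [measure_univ, mul_one] at hle
  have h4 := ENNReal.toReal_mono ENNReal.ofReal_ne_top hle
  have h2 := ENNReal.toReal_mono (hle.trans_lt ENNReal.ofReal_lt_top).ne hge
  rw [ENNReal.toReal_ofReal (by linarith [hε.1])] at h4
  rw [ENNReal.toReal_mul, ENNReal.toReal_ofReal (by linarith [hε.1])] at h2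
  exact ⟨by linarith, h4⟩

end ProdVolume

/-- For the SRB measure `μ = ν ⊗ Leb` of the baker map and the observable
`f(x,y) = (x+y)/2`, the local dimension of the image measure `f_*μ` at any `c ∈ (0,1)`
equals `1`. -/
theorem baker_mean_observable_image_dimension_one
    (α lamA lamB : ℝ) (hα : α ∈ Set.Ioo (0:ℝ) 1)
    (hlamA : lamA ∈ Set.Ioo (0:ℝ) 1) (hlamB : lamB ∈ Set.Ioo (0:ℝ) 1)
    (hsum : lamA + lamB ≤ 1)
    -- the Bernoulli product measure giving mass `α` to `0` (= `false`) and `1-α` to `1`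
    (bern : Measure (ℕ → Bool))
    (hbern : ∀ (n : ℕ) (v : ℕ → Bool), bern {ω | ∀ i < n, ω i = v i} =
      ∏ i ∈ Finset.range n, (if v i then ENNReal.ofReal (1 - α) else ENNReal.ofReal α))
    -- the self-similar measure `ν` and the SRB measure `μ = ν ⊗ Leb`
    (ν : Measure ℝ)
    (hν : ν = Measure.map
      (codingMap (fun x => lamA * x) (fun x => 1 - lamB + lamB * x)) bern)
    (μ : Measure (ℝ × ℝ)) (hμ : μ = ν.prod (volume.restrict (Set.Icc 0 1))) :
    ∀ c ∈ Set.Ioo (0:ℝ) 1,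
      Tendsto (fun ε : ℝ =>
          Real.log ((μ {p : ℝ × ℝ | |(p.1 + p.2) / 2 - c| ≤ ε}).toReal) / Real.log ε)
        (𝓝[>] 0) (nhds 1) := by
  intro c hc
  have h₀ : Monotone fun x : ℝ => lamA * x := fun x y h => mul_le_mul_of_nonneg_left h hlamA.1.le
  have h₁ : Monotone fun x : ℝ => 1 - lamB + lamB * x := fun x y h => by
    simpa using mul_le_mul_of_nonneg_left h hlamB.1.le
  have hz₀ : 0 ≤ lamA * 0 := by simp
  have hz₁ : 0 ≤ 1 - lamB + lamB * 0 := by linarith [hlamB.2]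
  have ho₀ : lamA * 1 ≤ 1 := by linarith [hlamA.2]
  have ho₁ : 1 - lamB + lamB * 1 ≤ 1 := by linarith
  have hmeas := measurable_codingMap h₀ h₁ hz₀ hz₁ ho₀ ho₁
  have hmem := codingMap_mem_Icc h₀ h₁ hz₀ hz₁ ho₀ ho₁
  have : IsProbabilityMeasure bern := ⟨by simpa using hbern 0 fun _ => false⟩
  have : IsProbabilityMeasure ν := hν ▸ Measure.isProbabilityMeasure_map hmeas.aemeasurable
  rw [hμ]
  refine tendsto_log_prod_volume_mean_ball_div_log ν c ?_
  rw [hν, Measure.map_apply hmeas measurableSet_Icc]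
  have hcyl (n : ℕ) (b : Bool) : 0 < bern {ω | ∀ i < n, ω i = b} := by
    rw [hbern n fun _ => b, CanonicallyOrderedAdd.prod_pos]
    intro i _
    split_ifs
    · exact ENNReal.ofReal_pos.2 (by linarith [hα.2])
    · exact ENNReal.ofReal_pos.2 hα.1
  rcases le_total c (1 / 2) with h | h
  · obtain ⟨n, hn⟩ := exists_pow_lt_of_lt_one (show 0 < 2 * c by linarith [hc.1]) hlamA.2
    refine (hcyl n false).trans_le (measure_mono fun ω hω => ?_)
    have hlow := (hmem ω 0).1
    have hup := (hmem ω n).2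
    rw [codePartial_eq_iterate_false hω, mul_left_iterate] at hup
    simp only [codePartial, id] at hlow
    exact ⟨by linarith, by linarith⟩
  · obtain ⟨n, hn⟩ := exists_pow_lt_of_lt_one (show 0 < 2 - 2 * c by linarith [hc.2]) hlamB.2
    refine (hcyl n true).trans_le (measure_mono fun ω hω => ?_)
    have hlow := (hmem ω n).1
    have hup := (hmem ω 0).2
    rw [codePartial_eq_iterate_true hω, iterate_one_sub_add_mul_zero] at hlow
    simp only [codePartial, id] at hup
    exact ⟨by linarith, by linarith⟩
end

section
/- Let μ_C denote the ternary Cantor measure on [0,1], defined as the pushforward of the infinite product over ℕ of the uniform Bernoulli measure on {0,1} under the map (a_n)_{n≥1} ↦ Σ_{n≥1} 2a_n 3^{−n}. For ε > 0 let Σ_ε = {(x,y) ∈ [0,1]² : |x − y| ≤ ε}. Then for every n ≥ 1, (μ_C ⊗ μ_C)(Σ_{3^{−n}}) ≥ 2^{−n}. Consequently, for the observable f(x,y) = y − x with target value f(0,0) = 0, the upper local dimension of the image measure at 0 satisfies limsup_{ε→0⁺} log (μ_C ⊗ μ_C)(Σ_ε) / log ε ≤ log 2/log 3. -/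
open MeasureTheory Set Filter Topology
open scoped ENNReal

/-- The coding map of the ternary Cantor set: `ω ↦ ∑_{n≥0} 2 ω_n 3^{-(n+1)}`. -/
noncomputable def cantorVal (ω : ℕ → Bool) : ℝ :=
  ∑' n : ℕ, (if ω n then 2 else 0) * (1/3 : ℝ) ^ (n + 1)

theorem summable_cantorVal (ω : ℕ → Bool) :
    Summable fun n : ℕ => (if ω n then 2 else 0) * (1/3 : ℝ) ^ (n + 1) := by
  have h : Summable fun n : ℕ => 2 * (1/3 : ℝ) ^ (n + 1) :=
    ((summable_nat_add_iff 1).2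
      (summable_geometric_of_lt_one (by norm_num) (by norm_num : (1/3 : ℝ) < 1))).mul_left 2
  refine Summable.of_nonneg_of_le (fun n => ?_) (fun n => ?_) h
  · positivity
  · gcongr
    split_ifs <;> norm_num

theorem cantorVal_nonneg (ω : ℕ → Bool) : 0 ≤ cantorVal ω :=
  tsum_nonneg fun n => by positivity

theorem cantorVal_le_one (ω : ℕ → Bool) : cantorVal ω ≤ 1 := by
  have h : HasSum (fun n : ℕ => 2 * (1/3 : ℝ) ^ (n + 1)) 1 := by
    have := (hasSum_geometric_of_lt_one (by norm_num) (by norm_num : (1/3 : ℝ) < 1)).mul_left (2/3)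
    convert! this using 1
    · ext n
      ring
    · norm_num
  refine hasSum_le (fun n => ?_) (summable_cantorVal ω).hasSum h
  gcongr
  split_ifs <;> norm_num

theorem cantorVal_eq_head_add (ω : ℕ → Bool) :
    cantorVal ω = (if ω 0 then 2 else 0) / 3 + cantorVal (fun n => ω (n + 1)) / 3 := by
  unfold cantorVal
  rw [(summable_cantorVal ω).tsum_eq_zero_add, ← tsum_div_const]
  congr 1
  · ring
  · exact tsum_congr fun n => by ring

/-- Two sequences sharing their first `n` digits have codes within `3^{-n}` of each other. -/
theorem abs_cantorVal_sub_le (n : ℕ) (ω v : ℕ → Bool) (h : ∀ i < n, ω i = v i) :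
    |cantorVal v - cantorVal ω| ≤ (1/3 : ℝ) ^ n := by
  induction n generalizing ω v with
  | zero =>
    rw [pow_zero, abs_le]
    constructor <;>
      linarith [cantorVal_nonneg ω, cantorVal_nonneg v, cantorVal_le_one ω, cantorVal_le_one v]
  | succ n ih =>
    have ih' := ih (fun k => ω (k + 1)) (fun k => v (k + 1)) fun i hi => h (i + 1) (by omega)
    rw [cantorVal_eq_head_add ω, cantorVal_eq_head_add v, h 0 n.succ_pos, pow_succ]
    rw [abs_le] at ih' ⊢
    constructor <;> linarith [ih'.1, ih'.2]

theorem measurable_cantorVal : Measurable cantorVal := by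
  have h (n : ℕ) : Measurable fun ω : ℕ → Bool => if ω n then (2 : ℝ) else 0 :=
    (measurable_of_countable fun b : Bool => if b then (2 : ℝ) else 0).comp (measurable_pi_apply n)
  refine measurable_of_tendsto_metrizable
    (f := fun N ω => ∑ n ∈ Finset.range N, (if ω n then 2 else 0) * (1/3 : ℝ) ^ (n + 1))
    (fun N => Finset.measurable_sum _ fun n _ => (h n).mul_const _)
    (tendsto_pi_nhds.2 fun ω => (summable_cantorVal ω).hasSum.tendsto_sum_nat)

theorem measurableSet_abs_sub_le (ε : ℝ) : MeasurableSet {p : ℝ × ℝ | |p.1 - p.2| ≤ ε} :=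
  (isClosed_le (by fun_prop) continuous_const).measurableSet

/-- If all cylinders of length `n` have mass `2^{-n}`, the product of the Cantor measure with
itself gives the `3^{-n}`-neighborhood of the diagonal at least this mass. -/
theorem half_pow_le_prod_map_cantorVal (bern : Measure (ℕ → Bool)) [IsProbabilityMeasure bern]
    (n : ℕ) (hbern : ∀ v : ℕ → Bool, bern {ω | ∀ i < n, ω i = v i} = (1/2 : ℝ≥0∞) ^ n) :
    (1/2 : ℝ≥0∞) ^ n ≤ ((bern.map cantorVal).prod (bern.map cantorVal))
      {p : ℝ × ℝ | |p.1 - p.2| ≤ (1/3 : ℝ) ^ n} := by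
  have : IsProbabilityMeasure (bern.map cantorVal) :=
    Measure.isProbabilityMeasure_map measurable_cantorVal.aemeasurable
  have hS := measurableSet_abs_sub_le ((1/3 : ℝ) ^ n)
  rw [Measure.prod_apply hS,
    lintegral_map (measurable_measure_prodMk_left hS) measurable_cantorVal]
  calc (1/2 : ℝ≥0∞) ^ n = ∫⁻ _, (1/2 : ℝ≥0∞) ^ n ∂bern := by simp
    _ ≤ _ := lintegral_mono fun v => by
      rw [Measure.map_apply measurable_cantorVal (measurable_prodMk_left hS), ← hbern v]
      exact measure_mono fun ω hω => abs_cantorVal_sub_le n ω v hω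

/-- A lower bound `2^{-n} ≤ m (3^{-n})` on a monotone function bounded by one yields the upper
bound `log 2 / log 3` on its growth exponent at zero. -/
theorem limsup_log_div_log_le (m : ℝ → ℝ) (hmono : Monotone m) (hm1 : ∀ ε, m ε ≤ 1)
    (hm : ∀ n : ℕ, 1 ≤ n → (1/2 : ℝ) ^ n ≤ m ((1/3 : ℝ) ^ n)) :
    Filter.limsup (fun ε : ℝ => Real.log (m ε) / Real.log ε) (𝓝[>] 0)
      ≤ Real.log 2 / Real.log 3 := by
  have hl2 : 0 < Real.log 2 := Real.log_pos (by norm_num)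
  have hl3 : 0 < Real.log 3 := Real.log_pos (by norm_num)
  have hlim : Tendsto (fun ε : ℝ => Real.log 2 / Real.log 3 - Real.log 2 / Real.log ε)
      (𝓝[>] 0) (𝓝 (Real.log 2 / Real.log 3)) := by
    simpa using (Real.tendsto_log_nhdsGT_zero.const_div_atBot (Real.log 2)).const_sub
      (Real.log 2 / Real.log 3)
  have hbounds : ∀ᶠ ε : ℝ in 𝓝[>] 0, 0 ≤ Real.log (m ε) / Real.log ε ∧
      Real.log (m ε) / Real.log ε ≤ Real.log 2 / Real.log 3 - Real.log 2 / Real.log ε := by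
    filter_upwards [Ioo_mem_nhdsGT (show (0 : ℝ) < 1 by norm_num)] with ε ⟨hε0, hε1⟩
    have hlε : Real.log ε < 0 := Real.log_neg hε0 hε1
    have hL : 0 < -Real.log ε / Real.log 3 := div_pos (neg_pos.2 hlε) hl3
    set n := ⌈-Real.log ε / Real.log 3⌉₊ with hn
    have hn1 : 1 ≤ n := Nat.ceil_pos.2 hL
    have hle : (1/3 : ℝ) ^ n ≤ ε := by
      rw [← Real.log_le_log_iff (by positivity) hε0, Real.log_pow, one_div, Real.log_inv]
      have := (div_le_iff₀ hl3).1 (Nat.le_ceil (-Real.log ε / Real.log 3))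
      linarith
    have hmε : (1/2 : ℝ) ^ n ≤ m ε := (hm n hn1).trans (hmono hle)
    have hmpos : 0 < m ε := lt_of_lt_of_le (by positivity) hmε
    have hlog : -(n * Real.log 2) ≤ Real.log (m ε) := by
      have := Real.log_le_log (by positivity) hmε
      rw [Real.log_pow, one_div, Real.log_inv] at this
      linarith
    refine ⟨div_nonneg_of_nonpos (Real.log_nonpos hmpos.le (hm1 ε)) hlε.le, ?_⟩
    have hnlt : (n : ℝ) < -Real.log ε / Real.log 3 + 1 := Nat.ceil_lt_add_one hL.le
    rw [div_le_iff_of_neg hlε, sub_mul, div_mul_cancel₀ _ hlε.ne]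
    calc Real.log 2 / Real.log 3 * Real.log ε - Real.log 2
        = -((-Real.log ε / Real.log 3 + 1) * Real.log 2) := by ring
      _ ≤ -(n * Real.log 2) := by gcongr
      _ ≤ _ := hlog
  rw [← hlim.limsup_eq]
  exact limsup_le_limsup (hbounds.mono fun _ h => h.2)
    (isCoboundedUnder_le_of_eventually_le _ (hbounds.mono fun _ h => h.1))
    hlim.isBoundedUnder_le

/-- For the product of two ternary Cantor measures, the `3^{-n}`-neighborhood of the
diagonal has measure at least `2^{-n}`; hence for the observable `f(x,y) = y - x` the
upper local dimension of the image measure at `0` is at most `log 2 / log 3`. -/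
theorem cantor_diagonal_observable_upper_dimension
    -- the uniform Bernoulli product measure on `{0,1}^ℕ`
    (bern : Measure (ℕ → Bool))
    (hbern : ∀ (n : ℕ) (v : ℕ → Bool),
      bern {ω | ∀ i < n, ω i = v i} = (1/2 : ℝ≥0∞) ^ n)
    -- the ternary Cantor measure
    (μC : Measure ℝ) (hμC : μC = Measure.map cantorVal bern) :
    (∀ n : ℕ, 1 ≤ n →
      (1/2 : ℝ≥0∞) ^ n ≤ (μC.prod μC) {p : ℝ × ℝ | |p.1 - p.2| ≤ (1/3 : ℝ) ^ n}) ∧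
    Filter.limsup (fun ε : ℝ =>
        Real.log (((μC.prod μC) {p : ℝ × ℝ | |p.1 - p.2| ≤ ε}).toReal) / Real.log ε)
      (𝓝[>] 0) ≤ Real.log 2 / Real.log 3 := by
  subst hμC
  have : IsProbabilityMeasure bern := ⟨by simpa using hbern 0 fun _ => false⟩
  have : IsProbabilityMeasure (bern.map cantorVal) :=
    Measure.isProbabilityMeasure_map measurable_cantorVal.aemeasurable
  have hmass (n : ℕ) := half_pow_le_prod_map_cantorVal bern n (hbern n)
  refine ⟨fun n _ => hmass n, ?_⟩
  refine limsup_log_div_log_le (fun ε => (((bern.map cantorVal).prod (bern.map cantorVal))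
    {p : ℝ × ℝ | |p.1 - p.2| ≤ ε}).toReal) (fun a b hab => ?_) (fun _ => measureReal_le_one)
    fun n _ => ?_
  · exact measureReal_mono fun p hp => le_trans hp hab
  · simpa using ENNReal.toReal_mono (measure_ne_top _ _) (hmass n)
end

section
/- Given b_1, b_2 ∈ [0,1) and μ_1, μ_2 ≥ 0 with μ_1 + μ_2 = 1, set θ = 1 − b_1μ_1 − b_2μ_2 and, for l ≥ 1, λ_l = (μ_1(1−b_1)² b_1^{l−1} + μ_2(1−b_2)² b_2^{l−1})/θ. Then θ > 0, the series Σ_{l≥1} λ_l and Σ_{l≥1} l·λ_l converge, Σ_{l=1}^∞ λ_l = 1, and Σ_{l=1}^∞ l·λ_l = 1/θ; that is, (λ_l) is a probability distribution on the positive integers whose mean equals the reciprocal of the extremal index θ. -/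
open Filter

/-- The series `∑ (1 - b)² bˡ` sums to `1 - b`. -/
theorem hasSum_sq_one_sub_mul_geometric {b : ℝ} (hb : b ∈ Set.Ico (0 : ℝ) 1) :
    HasSum (fun l : ℕ => (1 - b) ^ 2 * b ^ l) (1 - b) := by
  have hb' : 1 - b ≠ 0 := (sub_pos.2 hb.2).ne'
  convert! (hasSum_geometric_of_lt_one hb.1 hb.2).mul_left ((1 - b) ^ 2) using 1
  field_simp

/-- The series `∑ (l + 1) (1 - b)² bˡ` sums to `1`. -/
theorem hasSum_succ_mul_sq_one_sub_mul_geometric {b : ℝ} (hb : b ∈ Set.Ico (0 : ℝ) 1) :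
    HasSum (fun l : ℕ => ((l : ℝ) + 1) * ((1 - b) ^ 2 * b ^ l)) 1 := by
  have hb' : 1 - b ≠ 0 := (sub_pos.2 hb.2).ne'
  have hnorm : ‖b‖ < 1 := by rw [Real.norm_of_nonneg hb.1]; exact hb.2
  convert! ((hasSum_coe_mul_geometric_of_norm_lt_one hnorm).add
    (hasSum_geometric_of_lt_one hb.1 hb.2)).mul_left ((1 - b) ^ 2) using 1
  · ext l
    ring
  · field_simp
    ring

/-- The cluster-size parameters `λ_l` of the compound Poisson limit law form a probability
distribution on the positive integers with mean `1/θ`, where `θ = 1 - b₁μ₁ - b₂μ₂` is the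
extremal index. Here `λ_l` is indexed so that `lam l` is defined for `l ≥ 1`. -/
theorem compound_poisson_cluster_distribution
    (b₁ b₂ μ₁ μ₂ : ℝ)
    (hb₁ : b₁ ∈ Set.Ico (0:ℝ) 1) (hb₂ : b₂ ∈ Set.Ico (0:ℝ) 1)
    (hμ₁ : 0 ≤ μ₁) (hμ₂ : 0 ≤ μ₂) (hsum : μ₁ + μ₂ = 1)
    (θ : ℝ) (hθ : θ = 1 - b₁ * μ₁ - b₂ * μ₂)
    (lam : ℕ → ℝ)
    (hlam : ∀ l : ℕ, 1 ≤ l →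
      lam l = (μ₁ * (1 - b₁)^2 * b₁^(l - 1) + μ₂ * (1 - b₂)^2 * b₂^(l - 1)) / θ) :
    0 < θ ∧
    Summable (fun l : ℕ => lam (l + 1)) ∧
    Summable (fun l : ℕ => ((l : ℝ) + 1) * lam (l + 1)) ∧
    ∑' l : ℕ, lam (l + 1) = 1 ∧
    ∑' l : ℕ, ((l : ℝ) + 1) * lam (l + 1) = 1 / θ := by
  have hpos : 0 < θ := by
    have hb : 0 < min (1 - b₁) (1 - b₂) := lt_min (sub_pos.2 hb₁.2) (sub_pos.2 hb₂.2)
    have h₁ := mul_le_mul_of_nonneg_left (min_le_left (1 - b₁) (1 - b₂)) hμ₁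
    have h₂ := mul_le_mul_of_nonneg_left (min_le_right (1 - b₁) (1 - b₂)) hμ₂
    calc
      0 < (μ₁ + μ₂) * min (1 - b₁) (1 - b₂) := by rwa [hsum, one_mul]
      _ ≤ θ := by linarith
  have hmass : HasSum (fun l : ℕ => lam (l + 1)) 1 := by
    convert! (((hasSum_sq_one_sub_mul_geometric hb₁).mul_left μ₁).add
      ((hasSum_sq_one_sub_mul_geometric hb₂).mul_left μ₂)).div_const θ using 1
    · ext l
      rw [hlam (l + 1) (Nat.le_add_left 1 l), Nat.add_sub_cancel]
      ring
    · rw [eq_div_iff hpos.ne']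
      linarith
  have hmean : HasSum (fun l : ℕ => ((l : ℝ) + 1) * lam (l + 1)) (1 / θ) := by
    convert! (((hasSum_succ_mul_sq_one_sub_mul_geometric hb₁).mul_left μ₁).add
      ((hasSum_succ_mul_sq_one_sub_mul_geometric hb₂).mul_left μ₂)).div_const θ using 1
    · ext l
      rw [hlam (l + 1) (Nat.le_add_left 1 l), Nat.add_sub_cancel]
      ring
    · rw [mul_one, mul_one, hsum]
  exact ⟨hpos, hmass.summable, hmean.summable, hmass.tsum_eq, hmean.tsum_eq⟩
end

section
/- Given b_1, b_2 ∈ (0,1) with b_1 ≠ b_2 and μ_1, μ_2 ∈ (0,1) with μ_1 + μ_2 = 1, set θ = 1 − b_1μ_1 − b_2μ_2 and, for l ≥ 1, λ_l = (μ_1(1−b_1)² b_1^{l−1} + μ_2(1−b_2)² b_2^{l−1})/θ. Then the sequence (λ_l)_{l≥1} is not geometric: there exists no p ∈ [0,1) such that λ_l = (1−p)p^{l−1} for all l ≥ 1. Consequently, the associated compound Poisson distribution with parameters tθλ_l is not a Pólya–Aeppli distribution. If instead b_1 = b_2 = b, then λ_l = (1−b)b^{l−1} for all l ≥ 1, and the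 Pólya–Aeppli distribution with extremal index θ = 1 − b is recovered. -/
open Filter

/-- The Hankel determinant of a two-term exponential sum `A x ^ n + B y ^ n` does not vanish,
so its first three terms are not in geometric progression. -/
theorem two_exponential_sum_mul_ne_sq {A B x y : ℝ} (hA : A ≠ 0) (hB : B ≠ 0) (hxy : x ≠ y) :
    (A + B) * (A * x ^ 2 + B * y ^ 2) ≠ (A * x + B * y) ^ 2 := by
  intro h
  have hprod : A * B * (x - y) ^ 2 ≠ 0 :=
    mul_ne_zero (mul_ne_zero hA hB) (pow_ne_zero 2 (sub_ne_zero.mpr hxy))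
  exact hprod (by linear_combination h)

/-- With two distinct periodicities (`b₁ ≠ b₂`) the cluster-size distribution `(λ_l)` of
the compound Poisson limit law is not geometric, so the law is not Pólya–Aeppli; when
`b₁ = b₂ = b` it is geometric, `λ_l = (1-b) b^{l-1}`, and Pólya–Aeppli is recovered. -/
theorem compound_poisson_not_polya_aeppli
    (b₁ b₂ μ₁ μ₂ : ℝ)
    (hb₁ : b₁ ∈ Set.Ioo (0:ℝ) 1) (hb₂ : b₂ ∈ Set.Ioo (0:ℝ) 1)
    (hμ₁ : μ₁ ∈ Set.Ioo (0:ℝ) 1) (hμ₂ : μ₂ ∈ Set.Ioo (0:ℝ) 1)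
    (hsum : μ₁ + μ₂ = 1)
    (θ : ℝ) (hθ : θ = 1 - b₁ * μ₁ - b₂ * μ₂)
    (lam : ℕ → ℝ)
    (hlam : ∀ l : ℕ, 1 ≤ l →
      lam l = (μ₁ * (1 - b₁)^2 * b₁^(l - 1) + μ₂ * (1 - b₂)^2 * b₂^(l - 1)) / θ) :
    (b₁ ≠ b₂ →
      ¬ ∃ p : ℝ, 0 ≤ p ∧ p < 1 ∧ ∀ l : ℕ, 1 ≤ l → lam l = (1 - p) * p ^ (l - 1)) ∧
    (b₁ = b₂ → ∀ l : ℕ, 1 ≤ l → lam l = (1 - b₁) * b₁ ^ (l - 1)) := by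
  obtain ⟨hb₁0, hb₁1⟩ := hb₁
  obtain ⟨hb₂0, hb₂1⟩ := hb₂
  obtain ⟨hμ₁0, hμ₁1⟩ := hμ₁
  obtain ⟨hμ₂0, hμ₂1⟩ := hμ₂
  have hθ_pos : 0 < θ := by
    have h₁ : 0 < μ₁ * (1 - b₁) := mul_pos hμ₁0 (sub_pos.mpr hb₁1)
    have h₂ : 0 < μ₂ * (1 - b₂) := mul_pos hμ₂0 (sub_pos.mpr hb₂1)
    linarith
  have hθ_ne : θ ≠ 0 := hθ_pos.ne'
  constructor
  · rintro hne ⟨p, -, -, hp⟩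
    have hA : μ₁ * (1 - b₁) ^ 2 ≠ 0 :=
      mul_ne_zero hμ₁0.ne' (pow_ne_zero 2 (sub_pos.mpr hb₁1).ne')
    have hB : μ₂ * (1 - b₂) ^ 2 ≠ 0 :=
      mul_ne_zero hμ₂0.ne' (pow_ne_zero 2 (sub_pos.mpr hb₂1).ne')
    have hgeom : ∀ n : ℕ, μ₁ * (1 - b₁) ^ 2 * b₁ ^ n + μ₂ * (1 - b₂) ^ 2 * b₂ ^ n
        = (1 - p) * p ^ n * θ := by
      intro n
      have h := (hlam (n + 1) n.succ_pos).symm.trans (hp (n + 1) n.succ_pos)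
      rwa [Nat.add_sub_cancel, div_eq_iff hθ_ne] at h
    have h0 := hgeom 0
    have h1 := hgeom 1
    have h2 := hgeom 2
    simp only [pow_zero, pow_one, mul_one] at h0 h1
    refine two_exponential_sum_mul_ne_sq hA hB hne ?_
    rw [h0, h1, h2]
    ring
  · rintro rfl l hl
    have hθ' : θ = 1 - b₁ := by linear_combination hθ - b₁ * hsum
    rw [hlam l hl, div_eq_iff hθ_ne, hθ']
    linear_combination (1 - b₁) ^ 2 * b₁ ^ (l - 1) * hsum
end

section
/- Let T(x) = 3x mod 1 on [0,1), which preserves Lebesgue measure Leb, and let f(x) = (x − 1/2)(x − 1/4), with target value f_0 = 0; the preimages of 0 are the fixed point 1/2 and the point 1/4, which is periodic of minimal period 2 (T(1/4) = 3/4, T(3/4) = 1/4). For r > 0 write U_r = f^{−1}((−r, r)). Then: (i) lim_{r→0⁺} Leb(U_r ∩ T^{−1}U_r)/Leb(U_r) = 1/6; (ii) lim_{r→0⁺} Leb(U_r ∩ T^{−1}(U_r)^c ∩ T^{−2}U_r)/Leb(U_r) = 1/18; (iii) for every k ≥ 2, lim_{r→0⁺} Leb(U_r ∩ ⋂_{j=1}^{k}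 T^{−j}(U_r)^c ∩ T^{−(k+1)}U_r)/Leb(U_r) = 0. Consequently the extremal index is θ = 1 − 1/6 − 1/18 = 7/9. -/
open MeasureTheory Set Filter Topology
open scoped ENNReal

/-- The union of an asymmetric interval around `1/2` and its mirror image around `1/4`. -/
def twoWindows (α β : ℝ) : Set ℝ :=
  Ioo (1/2 - α) (1/2 + β) ∪ Ioo (1/4 - β) (1/4 + α)

theorem eventually_preimage_eq_twoWindows {ε : ℝ} (hε : 0 < ε) :
    ∀ᶠ r : ℝ in 𝓝[>] 0, ∃ α β : ℝ, 0 < α ∧ α < ε ∧ 0 < β ∧ β < ε ∧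
      (fun x : ℝ => (x - 1/2) * (x - 1/4)) ⁻¹' Ioo (-r) r = twoWindows α β := by
  have h64 : √(1/64 : ℝ) = 1/8 := by
    rw [Real.sqrt_eq_iff_mul_self_eq] <;> norm_num
  have hα : Tendsto (fun r : ℝ => 1/8 - √(1/64 - r)) (𝓝[>] 0) (𝓝 0) := by
    have : Continuous (fun r : ℝ => 1/8 - √(1/64 - r)) := by fun_prop
    simpa [h64] using (this.tendsto' 0 0 (by simp only [sub_zero, h64, sub_self])).mono_left
      nhdsWithin_le_nhds
  have hβ : Tendsto (fun r : ℝ => √(1/64 + r) - 1/8) (𝓝[>] 0) (𝓝 0) := by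
    have : Continuous (fun r : ℝ => √(1/64 + r) - 1/8) := by fun_prop
    exact (this.tendsto' 0 0 (by simp only [add_zero, h64, sub_self])).mono_left
      nhdsWithin_le_nhds
  have hr1 : ∀ᶠ r : ℝ in 𝓝[>] 0, r < 1/64 :=
    nhdsWithin_le_nhds (Iio_mem_nhds (by norm_num))
  filter_upwards [hα.eventually (gt_mem_nhds hε), hβ.eventually (gt_mem_nhds hε), hr1,
    self_mem_nhdsWithin] with r h1 h2 h3 h4
  have h0 : 0 < r := h4
  have ha2 : √(1/64 - r) ^ 2 = 1/64 - r := Real.sq_sqrt (by linarith)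
  have hb2 : √(1/64 + r) ^ 2 = 1/64 + r := Real.sq_sqrt (by linarith)
  have ha0 : 0 ≤ √(1/64 - r) := Real.sqrt_nonneg _
  have hb0 : 0 ≤ √(1/64 + r) := Real.sqrt_nonneg _
  generalize √(1/64 - r) = a at *
  generalize √(1/64 + r) = b at *
  refine ⟨1/8 - a, b - 1/8, by nlinarith, h1, by nlinarith, h2, ?_⟩
  ext x
  simp only [twoWindows, mem_preimage, mem_Ioo, mem_union]
  constructor
  · rintro ⟨hl, hu⟩
    have hlt : a ^ 2 < (x - 3/8) ^ 2 := by nlinarith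
    have hgt : (x - 3/8) ^ 2 < b ^ 2 := by nlinarith
    have h5 := abs_lt_of_sq_lt_sq' hgt hb0
    rcases lt_abs.1 (lt_of_pow_lt_pow_left₀ (a := a) 2 (abs_nonneg (x - 3/8)) (by rwa [sq_abs])) with h | h
    · left; constructor <;> linarith
    · right; constructor <;> linarith
  · rintro (⟨hl, hu⟩ | ⟨hl, hu⟩) <;> constructor <;> nlinarith

theorem tripling_near_half {T : ℝ → ℝ} (hT : ∀ x, T x = Int.fract (3 * x))
    {y : ℝ} (hy : |3 * y| < 1/4) : T (1/2 + y) = 1/2 + 3 * y := by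
  obtain ⟨h1, h2⟩ := abs_lt.1 hy
  rw [hT, Int.fract_eq_iff]
  exact ⟨by linarith, by linarith, 1, by push_cast; ring⟩

theorem tripling_near_quarter {T : ℝ → ℝ} (hT : ∀ x, T x = Int.fract (3 * x))
    {y : ℝ} (hy : |3 * y| < 1/4) : T (1/4 + y) = 3/4 + 3 * y := by
  obtain ⟨h1, h2⟩ := abs_lt.1 hy
  rw [hT, Int.fract_eq_iff]
  exact ⟨by linarith, by linarith, 0, by push_cast; ring⟩

theorem tripling_near_three_quarters {T : ℝ → ℝ} (hT : ∀ x, T x = Int.fract (3 * x))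
    {y : ℝ} (hy : |3 * y| < 1/4) :
    T (3/4 + y) = 1/4 + 3 * y := by
  obtain ⟨h1, h2⟩ := abs_lt.1 hy
  rw [hT, Int.fract_eq_iff]
  exact ⟨by linarith, by linarith, 2, by push_cast; ring⟩

theorem iterate_tripling_near_half {T : ℝ → ℝ} (hT : ∀ x, T x = Int.fract (3 * x))
    (n : ℕ) {y : ℝ} (hy : 3 ^ n * |y| < 1/4) :
    T^[n] (1/2 + y) = 1/2 + 3 ^ n * y := by
  induction n with
  | zero => simp
  | succ n ih =>
    have h : 0 ≤ 3 ^ n * |y| := by positivity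
    rw [pow_succ] at hy
    rw [Function.iterate_succ_apply', ih (by linarith), tripling_near_half hT]
    · ring
    · simp only [abs_mul, abs_pow, Nat.abs_ofNat]
      linarith

theorem iterate_tripling_near_quarter {T : ℝ → ℝ} (hT : ∀ x, T x = Int.fract (3 * x))
    (n : ℕ) {y : ℝ} (hy : 3 ^ n * |y| < 1/4) :
    T^[n] (1/4 + y) = (if Even n then 1/4 else 3/4) + 3 ^ n * y := by
  induction n with
  | zero => simp
  | succ n ih =>
    have h : 0 ≤ 3 ^ n * |y| := by positivity
    rw [pow_succ] at hy
    have h3 : |3 * (3 ^ n * y)| < 1/4 := by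
      simp only [abs_mul, abs_pow, Nat.abs_ofNat]
      linarith
    rw [Function.iterate_succ_apply', ih (by linarith)]
    by_cases hn : Even n
    · simp only [hn, if_true, Nat.even_add_one, not_true, if_false]
      rw [tripling_near_quarter hT h3]
      ring
    · simp only [hn, if_false, Nat.even_add_one, not_false_eq_true, if_true]
      rw [tripling_near_three_quarters hT h3]
      ring

theorem twoWindows_inter_preimage {T : ℝ → ℝ} (hT : ∀ x, T x = Int.fract (3 * x))
    {α β : ℝ} (hα : 0 < α) (hα' : α < 1/100) (hβ : 0 < β)
    (hβ' : β < 1/100) :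
    twoWindows α β ∩ T ⁻¹' twoWindows α β = Ioo (1/2 - α / 3) (1/2 + β / 3) := by
  have half (y : ℝ) (h1 : -α < y) (h2 : y < β) : T (1/2 + y) = 1/2 + 3 * y :=
    tripling_near_half hT (abs_lt.2 ⟨by linarith, by linarith⟩)
  have quarter (y : ℝ) (h1 : -β < y) (h2 : y < α) : T (1/4 + y) = 3/4 + 3 * y :=
    tripling_near_quarter hT (abs_lt.2 ⟨by linarith, by linarith⟩)
  ext x
  simp only [twoWindows, mem_inter_iff, mem_preimage, mem_Ioo, mem_union]
  constructor
  · rintro ⟨h | h, hx⟩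
    · have := half (x - 1/2) (by linarith) (by linarith)
      rw [add_sub_cancel] at this
      rw [this] at hx
      rcases hx with hx | hx <;> constructor <;> linarith
    · have := quarter (x - 1/4) (by linarith) (by linarith)
      rw [add_sub_cancel] at this
      rw [this] at hx
      rcases hx with hx | hx <;> constructor <;> linarith
  · rintro ⟨h1, h2⟩
    have := half (x - 1/2) (by linarith) (by linarith)
    rw [add_sub_cancel] at this
    rw [this]
    exact ⟨.inl ⟨by linarith, by linarith⟩, .inl ⟨by linarith, by linarith⟩⟩

theorem twoWindows_inter_second_preimage {T : ℝ → ℝ} (hT : ∀ x, T x = Int.fract (3 * x))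
    {α β : ℝ} (hα : 0 < α) (hα' : α < 1/100) (hβ : 0 < β)
    (hβ' : β < 1/100) :
    twoWindows α β ∩ T ⁻¹' (twoWindows α β)ᶜ ∩ T^[2] ⁻¹' twoWindows α β =
      Ioo (1/4 - β / 9) (1/4 + α / 9) := by
  have half (y : ℝ) (h1 : -α < y) (h2 : y < β) :
      T (1/2 + y) = 1/2 + 3 * y ∧ T^[2] (1/2 + y) = 1/2 + 3 ^ 2 * y := by
    have : |y| < 1/100 := abs_lt.2 ⟨by linarith, by linarith⟩
    exact ⟨tripling_near_half hT (abs_lt.2 ⟨by linarith, by linarith⟩),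
      iterate_tripling_near_half hT 2 (by linarith)⟩
  have quarter (y : ℝ) (h1 : -β < y) (h2 : y < α) :
      T (1/4 + y) = 3/4 + 3 * y ∧ T^[2] (1/4 + y) = 1/4 + 3 ^ 2 * y := by
    have : |y| < 1/100 := abs_lt.2 ⟨by linarith, by linarith⟩
    exact ⟨tripling_near_quarter hT (abs_lt.2 ⟨by linarith, by linarith⟩),
      by simpa using iterate_tripling_near_quarter hT 2 (y := y) (by linarith)⟩
  ext x
  simp only [twoWindows, mem_inter_iff, mem_preimage, mem_Ioo, mem_union, mem_compl_iff]
  constructor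
  · rintro ⟨⟨h | h, hx⟩, hx2⟩
    · have := half (x - 1/2) (by linarith) (by linarith)
      rw [add_sub_cancel] at this
      rw [this.1] at hx
      rw [this.2] at hx2
      refine absurd (.inl ?_) hx
      rcases hx2 with hx2 | hx2 <;> constructor <;> linarith
    · have := quarter (x - 1/4) (by linarith) (by linarith)
      rw [add_sub_cancel] at this
      rw [this.2] at hx2
      rcases hx2 with hx2 | hx2 <;> constructor <;> linarith
  · rintro ⟨h1, h2⟩
    have := quarter (x - 1/4) (by linarith) (by linarith)
    rw [add_sub_cancel] at this
    rw [this.1, this.2]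
    refine ⟨⟨.inr ⟨by linarith, by linarith⟩, ?_⟩, .inr ⟨by linarith, by linarith⟩⟩
    rintro (h | h) <;> linarith

theorem twoWindows_inter_late_return_eq_empty {T : ℝ → ℝ} (hT : ∀ x, T x = Int.fract (3 * x))
    {k : ℕ} (hk : 2 ≤ k) {α β : ℝ} (hα : 0 < α)
    (hα' : α < 1 / (100 * 3 ^ (k + 1))) (hβ : 0 < β) (hβ' : β < 1 / (100 * 3 ^ (k + 1))) :
    twoWindows α β ∩ (⋂ j ∈ Finset.Icc 1 k, T^[j] ⁻¹' (twoWindows α β)ᶜ) ∩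
      T^[k + 1] ⁻¹' twoWindows α β = ∅ := by
  have hp : (0 : ℝ) < 3 ^ (k + 1) := by positivity
  have hp9 : (9 : ℝ) ≤ 3 ^ (k + 1) := by
    calc (9 : ℝ) = 3 ^ 2 := by norm_num
      _ ≤ 3 ^ (k + 1) := pow_le_pow_right₀ (by norm_num) (by omega)
  have small (z : ℝ) (hz : z < 1 / (100 * 3 ^ (k + 1))) : 3 ^ (k + 1) * z < 1/100 := by
    rw [lt_div_iff₀ (by positivity)] at hz
    linarith
  have hα'' := small α hα'
  have hβ'' := small β hβ'
  generalize hP : (3 : ℝ) ^ (k + 1) = P at *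
  have hα9 : 9 * α < 1/100 := by nlinarith
  have hβ9 : 9 * β < 1/100 := by nlinarith
  rw [eq_empty_iff_forall_notMem]
  rintro x ⟨⟨hx, hj⟩, hx2⟩
  simp only [mem_iInter, mem_preimage, mem_compl_iff, Finset.mem_Icc] at hj hx2
  have hj1 := hj 1 ⟨le_rfl, by omega⟩
  have hj2 := hj 2 ⟨by norm_num, hk⟩
  simp only [twoWindows, mem_Ioo, mem_union] at hx hj1 hj2 hx2
  rcases hx with h | h
  · obtain ⟨y, rfl⟩ : ∃ y, x = 1/2 + y := ⟨x - 1/2, by ring⟩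
    have hy1 : P * y < 1/100 := by nlinarith
    have hy2 : -(1/100) < P * y := by nlinarith
    have hPy : P * |y| < 1/4 := by
      rw [← abs_of_pos hp, ← abs_mul, abs_lt]
      constructor <;> linarith
    rw [iterate_tripling_near_half hT (k + 1) (by rwa [hP]), hP] at hx2
    rw [iterate_tripling_near_half hT 1
      (by nlinarith [abs_nonneg y])] at hj1
    refine hj1 (.inl ?_)
    rcases hx2 with hx2 | hx2
    · constructor
      · rcases le_total 0 y with h0 | h0 <;> nlinarith
      · rcases le_total 0 y with h0 | h0 <;> nlinarith
    · linarith
  · obtain ⟨y, rfl⟩ : ∃ y, x = 1/4 + y := ⟨x - 1/4, by ring⟩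
    have hy1 : P * y < 1/100 := by nlinarith
    have hy2 : -(1/100) < P * y := by nlinarith
    have hPy : P * |y| < 1/4 := by
      rw [← abs_of_pos hp, ← abs_mul, abs_lt]
      constructor <;> linarith
    rw [iterate_tripling_near_quarter hT (k + 1) (by rwa [hP]), hP] at hx2
    rw [iterate_tripling_near_quarter hT 2
      (by nlinarith [abs_nonneg y]), if_pos even_two] at hj2
    split_ifs at hx2
    · refine hj2 (.inr ?_)
      rcases hx2 with hx2 | hx2
      · linarith
      · constructor
        · rcases le_total 0 y with h0 | h0 <;> nlinarith
        · rcases le_total 0 y with h0 | h0 <;> nlinarith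
    · rcases hx2 with hx2 | hx2 <;> linarith

theorem volume_restrict_Ico_Ioo_toReal {a b : ℝ} (ha : 0 ≤ a) (hab : a ≤ b) (hb : b ≤ 1) :
    ((volume.restrict (Ico (0 : ℝ) 1)) (Ioo a b)).toReal = b - a := by
  have hsub : Ioo a b ⊆ Ico 0 1 := fun x hx => ⟨ha.trans hx.1.le, hx.2.trans_le hb⟩
  rw [Measure.restrict_apply measurableSet_Ioo, inter_eq_left.2 hsub, Real.volume_Ioo,
    ENNReal.toReal_ofReal (by linarith)]

theorem volume_restrict_Ico_twoWindows_toReal {α β : ℝ} (hα : 0 < α) (hα' : α < 1/100)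
    (hβ : 0 < β) (hβ' : β < 1/100) :
    ((volume.restrict (Ico (0 : ℝ) 1)) (twoWindows α β)).toReal = 2 * (α + β) := by
  have hdisj : Disjoint (Ioo (1/2 - α) (1/2 + β)) (Ioo (1/4 - β) (1/4 + α)) :=
    Set.disjoint_left.2 fun x hx hx' => by linarith [hx.1, hx'.2]
  rw [twoWindows, measure_union hdisj measurableSet_Ioo,
    ENNReal.toReal_add (measure_ne_top _ _) (measure_ne_top _ _),
    volume_restrict_Ico_Ioo_toReal, volume_restrict_Ico_Ioo_toReal] <;> linarith

/-- For `T x = 3x mod 1` and the observable `f(x) = (x-1/2)(x-1/4)` with target value `0`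
(whose preimages are the fixed point `1/2` and the period-2 point `1/4`), the cluster
quantities satisfy `q₀ → 1/6`, `q₁ → 1/18`, `q_k → 0` for `k ≥ 2`, giving the extremal
index `θ = 1 - 1/6 - 1/18 = 7/9`. -/
theorem extremal_index_two_periodic_preimages_example
    (T f : ℝ → ℝ)
    (hT : ∀ x, T x = Int.fract (3 * x))
    (hf : ∀ x, f x = (x - 1/2) * (x - 1/4))
    (Leb : Measure ℝ) (hLeb : Leb = volume.restrict (Set.Ico 0 1))
    (U : ℝ → Set ℝ) (hU : ∀ r : ℝ, U r = f ⁻¹' Set.Ioo (-r) r) :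
    Tendsto (fun r : ℝ =>
        (Leb (U r ∩ T ⁻¹' U r)).toReal / (Leb (U r)).toReal)
      (𝓝[>] 0) (nhds (1/6)) ∧
    Tendsto (fun r : ℝ =>
        (Leb (U r ∩ T ⁻¹' (U r)ᶜ ∩ T^[2] ⁻¹' U r)).toReal / (Leb (U r)).toReal)
      (𝓝[>] 0) (nhds (1/18)) ∧
    (∀ k : ℕ, 2 ≤ k →
      Tendsto (fun r : ℝ =>
          (Leb (U r ∩ (⋂ j ∈ Finset.Icc 1 k, T^[j] ⁻¹' (U r)ᶜ) ∩
            T^[k+1] ⁻¹' U r)).toReal / (Leb (U r)).toReal)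
        (𝓝[>] 0) (nhds 0)) ∧
    (1 : ℝ) - 1/6 - 1/18 = 7/9 := by
  obtain rfl : f = fun x => (x - 1/2) * (x - 1/4) := funext hf
  subst hLeb
  have key (ε : ℝ) (hε : 0 < ε) := eventually_preimage_eq_twoWindows hε
  simp only [← hU] at key
  refine ⟨?_, ?_, fun k hk => ?_, by norm_num⟩
  · refine tendsto_const_nhds.congr' ?_
    filter_upwards [key (1/100) (by norm_num)] with r ⟨α, β, hα, hα', hβ, hβ', h⟩
    rw [h, twoWindows_inter_preimage hT hα hα' hβ hβ',
      volume_restrict_Ico_twoWindows_toReal hα hα' hβ hβ',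
      volume_restrict_Ico_Ioo_toReal (by linarith) (by linarith) (by linarith)]
    field_simp
    ring
  · refine tendsto_const_nhds.congr' ?_
    filter_upwards [key (1/100) (by norm_num)] with r ⟨α, β, hα, hα', hβ, hβ', h⟩
    rw [h, twoWindows_inter_second_preimage hT hα hα' hβ hβ',
      volume_restrict_Ico_twoWindows_toReal hα hα' hβ hβ',
      volume_restrict_Ico_Ioo_toReal (by linarith) (by linarith) (by linarith)]
    field_simp
    ring
  · refine tendsto_const_nhds.congr' ?_
    filter_upwards [key (1 / (100 * 3 ^ (k + 1))) (by positivity)]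
      with r ⟨α, β, hα, hα', hβ, hβ', h⟩
    rw [h, twoWindows_inter_late_return_eq_empty hT hk hα hα' hβ hβ']
    simp
end
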